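/- arXiv:math/0009185 — 15 statements merged into one kernel-verified Lean document; each statement's English description precedes it below -/
import Mathlib

section
/- Let q ∈ (0,1), c ∈ [0,∞), and let S be a unital complex star-algebra containing elements A, B satisfying A* = A, BA = q²AB, B*B = A − A² + c·1, BB* = q²A − q⁴A² + c·1. Set z_∞ := −(8c(1+q⁴)/(1+q²)² + 1)^{−1/2} and K := √(2(1+q⁴))/(1+q²), and define x := −i·K·z_∞·(B − B*), y := −K·z_∞·(B + B*), z := −(2(1+q⁴)/(1+q²))·z_∞·A + z_∞·1. Then x, y, z are self-adjoint (x* = x, y* = y, z* = z) and x² + y² + z² = 1. -/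
/-- The sum of squares of the two Cartesian combinations of `b` and `d`. -/
theorem smul_sub_sq_add_smul_add_sq {S : Type*} [Ring S] [Algebra ℂ S] (m : ℂ) (b d : S) :
    ((-Complex.I * m) • (b - d)) ^ 2 + ((-m) • (b + d)) ^ 2
      = (2 * m ^ 2) • (b * d + d * b) := by
  have hI : (-Complex.I * m) ^ 2 = -m ^ 2 := by
    rw [mul_pow, neg_sq, Complex.I_sq]; ring
  rw [smul_pow, smul_pow, hI, neg_sq]
  have h1 : (b - d) ^ 2 = b * b - b * d - d * b + d * d := by noncomm_ring
  have h2 : (b + d) ^ 2 = b * b + b * d + d * b + d * d := by noncomm_ring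
  rw [h1, h2]
  module

/-- The square of an affine combination of `a` and `1`. -/
theorem smul_add_smul_one_sq {S : Type*} [Ring S] [Algebra ℂ S] (s t : ℂ) (a : S) :
    (s • a + t • (1 : S)) ^ 2 = (s ^ 2) • a ^ 2 + (2 * s * t) • a + (t ^ 2) • (1 : S) := by
  simp only [pow_two, mul_add, add_mul, smul_mul_smul_comm, mul_one, one_mul]
  module

/-- Cartesian coordinates for the Podleś quantum sphere `S²_{qc}`, `c ∈ [0,∞)`:
in any unital complex star-algebra containing elements `A, B` satisfying the defining
relations of `P(S²_{qc})`, the elements `x, y, z` built from the stated real constants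
are self-adjoint and satisfy the sphere equation `x² + y² + z² = 1`. -/
theorem stmt_0 {S : Type*} [Ring S] [Algebra ℂ S] [StarRing S] [StarModule ℂ S]
    (q c : ℝ) (hq : 0 < q) (hq1 : q < 1) (hc : 0 ≤ c)
    (A B : S)
    (hA : star A = A)
    (hBA : B * A = ((q : ℂ) ^ 2) • (A * B))
    (hBsB : star B * B = A - A ^ 2 + ((c : ℝ) : ℂ) • (1 : S))
    (hBBs : B * star B = ((q : ℂ) ^ 2) • A - ((q : ℂ) ^ 4) • A ^ 2 + ((c : ℝ) : ℂ) • (1 : S))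
    (zinf K : ℝ)
    (hzinf : zinf = -(Real.sqrt (8 * c * (1 + q ^ 4) / (1 + q ^ 2) ^ 2 + 1))⁻¹)
    (hK : K = Real.sqrt (2 * (1 + q ^ 4)) / (1 + q ^ 2))
    (x y z : S)
    (hx : x = (-Complex.I * ((K : ℂ) * (zinf : ℂ))) • (B - star B))
    (hy : y = ((-(K * zinf) : ℝ) : ℂ) • (B + star B))
    (hz : z = ((-(2 * (1 + q ^ 4) / (1 + q ^ 2)) * zinf : ℝ) : ℂ) • A
            + ((zinf : ℝ) : ℂ) • (1 : S)) :
    star x = x ∧ star y = y ∧ star z = z ∧ x ^ 2 + y ^ 2 + z ^ 2 = 1 := by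
  have hq2 : (0 : ℝ) < 1 + q ^ 2 := by positivity
  have hKsq : K ^ 2 = 2 * (1 + q ^ 4) / (1 + q ^ 2) ^ 2 := by
    rw [hK, div_pow, Real.sq_sqrt (by positivity)]
  have hzsq : zinf ^ 2 * (8 * c * (1 + q ^ 4) / (1 + q ^ 2) ^ 2 + 1) = 1 := by
    have hpos : 0 < 8 * c * (1 + q ^ 4) / (1 + q ^ 2) ^ 2 + 1 := by positivity
    rw [hzinf, neg_sq, inv_pow, Real.sq_sqrt hpos.le, inv_mul_cancel₀ hpos.ne']
  set m : ℝ := K * zinf with hm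
  set s : ℝ := -(2 * (1 + q ^ 4) / (1 + q ^ 2)) * zinf with hs
  have hmsq : m ^ 2 = 2 * (1 + q ^ 4) / (1 + q ^ 2) ^ 2 * zinf ^ 2 := by
    rw [hm, mul_pow, hKsq]
  have hlin : 2 * m ^ 2 * (1 + q ^ 2) + 2 * s * zinf = 0 := by
    rw [hmsq, hs]; field_simp; ring
  have hquad : -(2 * m ^ 2 * (1 + q ^ 4)) + s ^ 2 = 0 := by
    rw [hmsq, hs]; field_simp; ring
  have hconst : 4 * m ^ 2 * c + zinf ^ 2 = 1 := by
    rw [hmsq]; linear_combination hzsq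
  have hlin' : 2 * (m : ℂ) ^ 2 * (1 + (q : ℂ) ^ 2) + 2 * s * zinf = 0 := by exact_mod_cast hlin
  have hquad' : -(2 * (m : ℂ) ^ 2 * (1 + (q : ℂ) ^ 4)) + (s : ℂ) ^ 2 = 0 := by
    exact_mod_cast hquad
  have hconst' : 4 * (m : ℂ) ^ 2 * c + (zinf : ℂ) ^ 2 = 1 := by exact_mod_cast hconst
  refine ⟨?_, ?_, ?_, ?_⟩
  · rw [hx, star_smul, star_sub, star_star, ← neg_sub B, smul_neg, ← neg_smul]
    simp
  · rw [hy, star_smul, star_add, star_star, add_comm (star B)]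
    simp
  · rw [hz, star_add, star_smul, star_smul, hA, star_one]
    simp
  · rw [hx, hy, hz, ← Complex.ofReal_mul, ← hm, Complex.ofReal_neg,
      smul_sub_sq_add_smul_add_sq, smul_add_smul_one_sq, hBsB, hBBs]
    linear_combination (norm := module) hlin' • A + hquad' • A ^ 2 + hconst' • (1 : S)
end

section
/- Let q ∈ (0,1) and c ∈ (0,∞). On the Hilbert space H = ℓ²(ℕ,ℂ) with standard orthonormal basis (e_k)_{k∈ℕ}, define bounded operators: A_± e_k = ±q^{2k} e_k, B_± e_k = (1−q^{4k})^{1/2} e_{k−1} (with B_± e_0 = 0), A^c_± e_k = λ_± q^{2k} e_k, and B^c_± e_k = c_±(k)^{1/2} e_{k−1} (with B^c_± e_0 = 0). Define F_c : [−1,1] → ℝ by F_c(x) = λ_+ x for x ≥ 0 and F_c(x) = −λ_− x for x < 0, and G_c : [−1,1] → ℝ by G_c(x) = (1−q⁴x²)^{−1/2}·η_c(q²λ_+ x) for x ≥ 0 and G_c(x) = (1−q⁴x²)^{−1/2}·η_c(−q²λ_− x) for x < 0, where η_c(t) = √(t − t² + c). Then F_c and G_c are continuous on [−1,1], and A^c_±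 = F_c(A_±) and B^c_± = G_c(A_±)·B_±, where F_c(A_±) and G_c(A_±) are given by the continuous functional calculus applied to the self-adjoint operator A_±. -/
namespace ContinuousLinearMap

/-- The continuous functional calculus acts on an eigenvector with eigenvalue `μ` as
multiplication by `f μ`. -/
theorem cfc_apply_of_apply_eq_smul {H : Type*} [NormedAddCommGroup H] [InnerProductSpace ℂ H]
    [CompleteSpace H] {A : H →L[ℂ] H} (hA : IsSelfAdjoint A) {f : ℝ → ℝ}
    (hf : ContinuousOn f (spectrum ℝ A)) {v : H} (hv : v ≠ 0) {μ : ℝ}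
    (h : A v = (μ : ℂ) • v) : cfc f A v = (f μ : ℂ) • v := by
  have hμ : μ ∈ spectrum ℝ A := by
    rintro ⟨u, hu⟩
    have h0 : (u : H →L[ℂ] H) v = 0 := by
      rw [hu, sub_apply, h, algebraMap_apply, Complex.coe_smul, sub_self]
    have h1 : ((↑u⁻¹ : H →L[ℂ] H) * u) v = v := by simp
    rw [mul_apply_eq_comp, h0, map_zero] at h1
    exact hv h1.symm
  have key (g : C(spectrum ℝ A, ℝ)) :
      cfcHom hA (R := ℝ) g v = (g ⟨μ, hμ⟩ : ℂ) • v := by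
    induction g using ContinuousMap.induction_on_of_compact with
    | const r =>
      have : ContinuousMap.const (spectrum ℝ A) r = algebraMap ℝ C(spectrum ℝ A, ℝ) r := rfl
      rw [this, AlgHomClass.commutes, algebraMap_apply, ← Complex.coe_smul]
      rfl
    | id => rw [cfcHom_id hA, h]; rfl
    | star_id => rw [star_trivial, cfcHom_id hA, h]; rfl
    | add f g hf hg =>
      rw [map_add, add_apply, hf, hg, ContinuousMap.add_apply, Complex.ofReal_add, add_smul]
    | mul f g hf hg =>
      rw [map_mul, mul_apply_eq_comp, hg, map_smul, hf, ContinuousMap.mul_apply, Complex.ofReal_mul,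
        smul_smul, mul_comm]
    | frequently g hg =>
      refine hg.mem_of_closed (isClosed_eq ?_ ?_)
      · exact (ContinuousLinearMap.apply ℂ H v).continuous.comp (cfcHom_continuous hA)
      · exact (Complex.continuous_ofReal.comp (continuous_eval_const _)).smul
          continuous_const
  rw [cfc_apply f A hA hf, key]
  rfl

end ContinuousLinearMap

namespace HilbertBasis

variable {ι H : Type*} [NormedAddCommGroup H] [InnerProductSpace ℂ H] (e : HilbertBasis ι ℂ H)

theorem continuousLinearMap_ext {A B : H →L[ℂ] H} (h : ∀ i, A (e i) = B (e i)) : A = B :=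
  ContinuousLinearMap.ext_on (Submodule.dense_iff_topologicalClosure_eq_top.mpr e.dense_span)
    (by rintro _ ⟨i, rfl⟩; exact h i)

theorem ne_zero (i : ι) : e i ≠ 0 := e.orthonormal.ne_zero i

variable [CompleteSpace H] {A : H →L[ℂ] H} {d : ι → ℝ}

theorem isSelfAdjoint_of_apply_eq_smul (h : ∀ i, A (e i) = (d i : ℂ) • e i) :
    IsSelfAdjoint A := by
  classical
  refine e.continuousLinearMap_ext fun i ↦ e.repr.injective (lp.ext (funext fun j ↦ ?_))
  rw [e.repr_apply_apply, e.repr_apply_apply, ContinuousLinearMap.star_eq_adjoint,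
    ContinuousLinearMap.adjoint_inner_right, h, h, inner_smul_left, inner_smul_right,
    Complex.conj_ofReal, orthonormal_iff_ite.mp e.orthonormal j i]
  split_ifs with hji
  · rw [hji]
  · simp

theorem norm_le_of_apply_eq_smul (h : ∀ i, A (e i) = (d i : ℂ) • e i) {C : ℝ} (hC : 0 ≤ C)
    (hd : ∀ i, |d i| ≤ C) : ‖A‖ ≤ C := by
  have hsa := e.isSelfAdjoint_of_apply_eq_smul h
  refine A.opNorm_le_bound hC fun x ↦ ?_
  have hx : C * ‖x‖ = ‖(C : ℂ) • e.repr x‖ := by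
    rw [norm_smul, e.repr.norm_map, Complex.norm_of_nonneg hC]
  rw [hx, ← e.repr.norm_map]
  refine lp.norm_mono (by simp) fun i ↦ ?_
  have hi : inner ℂ (e i) (A x) = (d i : ℂ) * inner ℂ (e i) x := by
    rw [← ContinuousLinearMap.adjoint_inner_left, hsa.adjoint_eq, h, inner_smul_left,
      Complex.conj_ofReal]
  rw [lp.coeFn_smul, Pi.smul_apply, e.repr_apply_apply, e.repr_apply_apply, hi, norm_mul,
    norm_smul, Complex.norm_real, Complex.norm_of_nonneg hC, Real.norm_eq_abs]
  gcongr
  exact hd i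

end HilbertBasis

open ContinuousLinearMap in
/-- Explicit form of the isomorphism `χ_c` between the Podleś spheres `C(S²_{qc})` and
`C(S²_{q∞})` on the level of the infinite-dimensional representations `π_±` and `π^c_±`:
with `s = ±1` singling out the representation, `λ_± = 1/2 ± √(c+1/4)`,
`c_±(k) = λ_± q^{2k} - (λ_± q^{2k})² + c`, and with the piecewise functions `F_c, G_c`,
one has `A^c_± = F_c(A_±)` and `B^c_± = G_c(A_±) B_±`, and `F_c, G_c` are continuous
on `[-1,1]`. -/
theorem stmt_1 {H : Type*} [NormedAddCommGroup H] [InnerProductSpace ℂ H] [CompleteSpace H]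
    (e : HilbertBasis ℕ ℂ H) (q c : ℝ) (hq : 0 < q) (hq1 : q < 1) (hc : 0 < c)
    (s : ℝ) (hs : s = 1 ∨ s = -1)
    (lam : ℝ) (hlam : lam = 1 / 2 + s * Real.sqrt (c + 1 / 4))
    (A B Ac Bc : H →L[ℂ] H)
    (hA : ∀ k : ℕ, A (e k) = ((s * q ^ (2 * k) : ℝ) : ℂ) • e k)
    (hB0 : B (e 0) = 0)
    (hB : ∀ k : ℕ, B (e (k + 1)) = ((Real.sqrt (1 - q ^ (4 * (k + 1))) : ℝ) : ℂ) • e k)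
    (hAc : ∀ k : ℕ, Ac (e k) = ((lam * q ^ (2 * k) : ℝ) : ℂ) • e k)
    (hBc0 : Bc (e 0) = 0)
    (hBc : ∀ k : ℕ, Bc (e (k + 1)) =
      ((Real.sqrt (lam * q ^ (2 * (k + 1)) - (lam * q ^ (2 * (k + 1))) ^ 2 + c) : ℝ) : ℂ) • e k)
    (F G : ℝ → ℝ)
    (hF : ∀ x : ℝ, F x = if 0 ≤ x then (1 / 2 + Real.sqrt (c + 1 / 4)) * x
        else -((1 / 2 - Real.sqrt (c + 1 / 4)) * x))
    (hG : ∀ x : ℝ, G x = (Real.sqrt (1 - q ^ 4 * x ^ 2))⁻¹ *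
        (if 0 ≤ x then
          Real.sqrt (q ^ 2 * (1 / 2 + Real.sqrt (c + 1 / 4)) * x
            - (q ^ 2 * (1 / 2 + Real.sqrt (c + 1 / 4)) * x) ^ 2 + c)
        else
          Real.sqrt (-(q ^ 2 * (1 / 2 - Real.sqrt (c + 1 / 4)) * x)
            - (-(q ^ 2 * (1 / 2 - Real.sqrt (c + 1 / 4)) * x)) ^ 2 + c))) :
    ContinuousOn F (Set.Icc (-1 : ℝ) 1) ∧ ContinuousOn G (Set.Icc (-1 : ℝ) 1) ∧
    Ac = cfc F A ∧ Bc = cfc G A * B := by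
  have hFc : Continuous F := by
    rw [funext hF]
    exact Continuous.if_le (by fun_prop) (by fun_prop) continuous_const continuous_id
      (by rintro x rfl; simp)
  have hGc : ContinuousOn G (Set.Icc (-1 : ℝ) 1) := by
    rw [funext hG]
    refine ContinuousOn.mul (ContinuousOn.inv₀ (by fun_prop) fun x hx ↦ ?_) ?_
    · have hx2 : x ^ 2 ≤ 1 := by nlinarith [hx.1, hx.2]
      have hq4 : q ^ 4 < 1 := pow_lt_one₀ hq.le hq1 (by norm_num)
      have hq4' : 0 < q ^ 4 := by positivity
      exact (Real.sqrt_pos.mpr (by nlinarith)).ne'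
    · exact (Continuous.if_le (by fun_prop) (by fun_prop) continuous_const continuous_id
        (by rintro x rfl; simp)).continuousOn
  refine ⟨hFc.continuousOn, hGc, ?_⟩
  have hsa := e.isSelfAdjoint_of_apply_eq_smul hA
  have hnorm : ‖A‖ ≤ 1 := e.norm_le_of_apply_eq_smul hA zero_le_one fun k ↦ by
    have hs1 : |s| = 1 := by rcases hs with rfl | rfl <;> simp
    rw [abs_mul, hs1, one_mul, abs_of_nonneg (by positivity)]
    exact pow_le_one₀ hq.le hq1.le
  have hspec : spectrum ℝ A ⊆ Set.Icc (-1) 1 := fun x hx ↦ by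
    have : Nontrivial H := ⟨e 0, 0, e.ne_zero 0⟩
    exact abs_le.mp ((spectrum.norm_le_norm_of_mem hx).trans hnorm)
  have hpow (k : ℕ) : 0 < q ^ (2 * k) := by positivity
  constructor
  · refine e.continuousLinearMap_ext fun k ↦ ?_
    rw [ContinuousLinearMap.cfc_apply_of_apply_eq_smul hsa hFc.continuousOn (e.ne_zero k) (hA k),
      hAc]
    congr 2
    rw [hF, hlam]
    rcases hs with rfl | rfl
    · rw [if_pos (by simpa using (hpow k).le)]
      ring
    · rw [if_neg (by simpa using hpow k)]
      ring
  · refine e.continuousLinearMap_ext fun k ↦ ?_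
    rw [mul_apply_eq_comp]
    rcases k with _ | k
    · rw [hBc0, hB0, map_zero]
    rw [hB, map_smul, ContinuousLinearMap.cfc_apply_of_apply_eq_smul hsa (hGc.mono hspec)
      (e.ne_zero k) (hA k), hBc, smul_smul, ← Complex.ofReal_mul]
    congr 2
    have hne : Real.sqrt (1 - q ^ (4 * (k + 1))) ≠ 0 :=
      (Real.sqrt_pos.mpr (sub_pos.mpr (pow_lt_one₀ hq.le hq1 (by lia)))).ne'
    have hden : 1 - q ^ 4 * (s * q ^ (2 * k)) ^ 2 = 1 - q ^ (4 * (k + 1)) := by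
      rcases hs with rfl | rfl <;> ring
    rw [hG, hden, mul_inv_cancel_left₀ hne, hlam]
    rcases hs with rfl | rfl
    · rw [if_pos (by simpa using (hpow k).le)]
      congr 1
      ring
    · rw [if_neg (by simpa using hpow k)]
      congr 1
      ring
end

section
/- Let q ∈ (0,1), c ∈ (0,∞), and let g ∈ ℂ with |g| = 1. On H = ℓ²(ℕ,ℂ) with orthonormal basis (e_k)_{k∈ℕ}, let W_g be the unitary operator with W_g e_k = g^{−2k} e_k, and let A^c_± e_k = λ_± q^{2k} e_k and B^c_± e_k = c_±(k)^{1/2} e_{k−1} (with B^c_± e_0 = 0). Then W_g A^c_± W_g* = A^c_± and W_g B^c_± W_g* = g²·B^c_±. Consequently, the U(1)-action δ_g, determined on generators by A_c ↦ A_c and B_c ↦ g²B_c, is unitarily implemented in each of the representations π^c_±. -/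
/-- Continuous linear maps that agree on a Hilbert basis are equal. -/
theorem HilbertBasis.continuousLinearMap_ext_s2 {ι 𝕜 E F : Type*} [RCLike 𝕜]
    [NormedAddCommGroup E] [InnerProductSpace 𝕜 E] [NormedAddCommGroup F] [NormedSpace 𝕜 F]
    (b : HilbertBasis ι 𝕜 E) {S T : E →L[𝕜] F} (h : ∀ i, S (b i) = T (b i)) : S = T := by
  refine ContinuousLinearMap.ext_on (s := Set.range b) ?_ ?_
  · exact Submodule.dense_iff_topologicalClosure_eq_top.mpr b.dense_span
  · rintro _ ⟨i, rfl⟩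
    exact h i


open ContinuousLinearMap in
/-- The `U(1)`-action `δ_g` (`A_c ↦ A_c`, `B_c ↦ g²B_c`) on the Podleś sphere `S²_{qc}`
is unitarily implemented in the representations `π^c_±`: the unitary `W_g e_k = g^{-2k} e_k`
satisfies `W_g A^c_± W_g* = A^c_±` and `W_g B^c_± W_g* = g² B^c_±`. -/
theorem stmt_2 {H : Type*} [NormedAddCommGroup H] [InnerProductSpace ℂ H] [CompleteSpace H]
    (e : HilbertBasis ℕ ℂ H) (q c : ℝ) (hq : 0 < q) (hq1 : q < 1) (hc : 0 < c)
    (g : ℂ) (hg : ‖g‖ = 1)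
    (s : ℝ) (hs : s = 1 ∨ s = -1)
    (lam : ℝ) (hlam : lam = 1 / 2 + s * Real.sqrt (c + 1 / 4))
    (W Ac Bc : H →L[ℂ] H)
    (hW : ∀ k : ℕ, W (e k) = (g ^ (2 * k))⁻¹ • e k)
    (hWunitary : adjoint W * W = 1 ∧ W * adjoint W = 1)
    (hAc : ∀ k : ℕ, Ac (e k) = ((lam * q ^ (2 * k) : ℝ) : ℂ) • e k)
    (hBc0 : Bc (e 0) = 0)
    (hBc : ∀ k : ℕ, Bc (e (k + 1)) =
      ((Real.sqrt (lam * q ^ (2 * (k + 1)) - (lam * q ^ (2 * (k + 1))) ^ 2 + c) : ℝ) : ℂ) • e k) :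
    W * Ac * adjoint W = Ac ∧ W * Bc * adjoint W = (g ^ 2) • Bc := by
  have hg0 : g ≠ 0 := by
    rintro rfl
    simp at hg
  have hA : W * Ac = Ac * W := e.continuousLinearMap_ext_s2 fun k => by
    change W (Ac (e k)) = Ac (W (e k))
    simp only [hAc, hW, map_smul]
    exact smul_comm _ _ _
  have hB : W * Bc = (g ^ 2 • Bc) * W := e.continuousLinearMap_ext_s2 fun k => by
    cases k with
    | zero => simp [hW, hBc0]
    | succ k =>
      change W (Bc (e (k + 1))) = g ^ 2 • Bc (W (e (k + 1)))
      simp only [hBc, hW, map_smul, smul_smul]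
      congr 1
      field_simp
      ring
  constructor
  · rw [hA, mul_assoc, hWunitary.2, mul_one]
  · rw [hB, mul_assoc, hWunitary.2, mul_one]
end

section
/- Let q ∈ (0,1) and let S be a unital complex star-algebra generated by elements A, B (and their stars) satisfying A* = A, BA = q²AB, B*B = −A² + 1, BB* = −q⁴A² + 1. Assume the monomials A^k B^l (k,l ∈ ℕ) together with A^m (B*)^n (m ∈ ℕ, n ≥ 1) are ℂ-linearly independent in S, and suppose r₁ : S → S is a star-algebra automorphism with r₁(A) = −A and r₁(B) = B. Then the fixed-point set {a ∈ S : r₁(a) = a} equals the smallest star-subalgebra of S containing B, and the element B satisfies BB* − q⁴B*B = (1 − q⁴)·1, i.e., x := B* satisfies the defining relation x*x − q⁴xx* = (1 − q⁴)·1 of the polynomial algebra of the quantum disc D_{q⁴}. -/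
/-- If `B` and `star B` commute with `A` up to elements of `StarAlgebra.adjoin ℂ {B}` on the right,
then so does every element of `StarAlgebra.adjoin ℂ {B}`. -/
theorem exists_mul_eq_mul_of_mem_adjoin_singleton {S : Type*} [Ring S] [Algebra ℂ S] [StarRing S]
    [StarModule ℂ S] {A B : S}
    (hB : ∃ e ∈ StarAlgebra.adjoin ℂ ({B} : Set S), B * A = A * e)
    (hB' : ∃ e ∈ StarAlgebra.adjoin ℂ ({B} : Set S), star B * A = A * e)
    {d : S} (hd : d ∈ StarAlgebra.adjoin ℂ ({B} : Set S)) :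
    ∃ e ∈ StarAlgebra.adjoin ℂ ({B} : Set S), d * A = A * e := by
  have hd' : d ∈ Algebra.adjoin ℂ ({B} ∪ star {B} : Set S) := hd
  clear hd
  induction hd' using Algebra.adjoin_induction with
  | mem x hx =>
    simp only [Set.star_singleton, Set.mem_union, Set.mem_singleton_iff] at hx
    rcases hx with rfl | rfl
    · exact hB
    · exact hB'
  | algebraMap c => exact ⟨algebraMap ℂ S c, algebraMap_mem _ c, Algebra.commutes c A⟩
  | add x y _ _ hx hy =>
    obtain ⟨x', hx', hx⟩ := hx
    obtain ⟨y', hy', hy⟩ := hy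
    exact ⟨x' + y', add_mem hx' hy', by rw [add_mul, mul_add, hx, hy]⟩
  | mul x y _ _ hx hy =>
    obtain ⟨x', hx', hx⟩ := hx
    obtain ⟨y', hy', hy⟩ := hy
    exact ⟨x' * y', mul_mem hx' hy', by rw [mul_assoc, hy, ← mul_assoc, hx, mul_assoc]⟩

/-- If `A` is self-adjoint, `A ^ 2` lies in `D := StarAlgebra.adjoin ℂ {B}` and `D * A ⊆ A * D`,
then the star-subalgebra generated by `A` and `B` is contained in `D + A * D`. -/
theorem exists_eq_add_mul_of_mem_adjoin_pair {S : Type*} [Ring S] [Algebra ℂ S] [StarRing S]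
    [StarModule ℂ S] {A B : S} (hA : star A = A)
    (hA2 : A ^ 2 ∈ StarAlgebra.adjoin ℂ ({B} : Set S))
    (hcomm : ∀ d ∈ StarAlgebra.adjoin ℂ ({B} : Set S),
      ∃ e ∈ StarAlgebra.adjoin ℂ ({B} : Set S), d * A = A * e)
    {a : S} (ha : a ∈ StarAlgebra.adjoin ℂ ({A, B} : Set S)) :
    ∃ d ∈ StarAlgebra.adjoin ℂ ({B} : Set S), ∃ e ∈ StarAlgebra.adjoin ℂ ({B} : Set S),
      a = d + A * e := by
  have hBmem : B ∈ StarAlgebra.adjoin ℂ ({B} : Set S) := StarAlgebra.self_mem_adjoin_singleton ℂ B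
  have ha' : a ∈ Algebra.adjoin ℂ ({A, B} ∪ star {A, B} : Set S) := ha
  clear ha
  induction ha' using Algebra.adjoin_induction with
  | mem x hx =>
    have hx' : x = A ∨ x = B ∨ x = star B := by
      simp only [Set.mem_union, Set.mem_star, Set.mem_insert_iff, Set.mem_singleton_iff,
        star_eq_iff_star_eq, hA] at hx
      grind
    rcases hx' with rfl | rfl | rfl
    · exact ⟨0, zero_mem _, 1, one_mem _, by simp⟩
    · exact ⟨x, hBmem, 0, zero_mem _, by simp⟩
    · exact ⟨star B, star_mem hBmem, 0, zero_mem _, by simp⟩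
  | algebraMap c => exact ⟨algebraMap ℂ S c, algebraMap_mem _ c, 0, zero_mem _, by simp⟩
  | add x y _ _ hx hy =>
    obtain ⟨d, hd, e, he, rfl⟩ := hx
    obtain ⟨d', hd', e', he', rfl⟩ := hy
    exact ⟨d + d', add_mem hd hd', e + e', add_mem he he', by rw [mul_add]; abel⟩
  | mul x y _ _ hx hy =>
    obtain ⟨d, hd, e, he, rfl⟩ := hx
    obtain ⟨d', hd', e', he', rfl⟩ := hy
    obtain ⟨f, hf, hdf⟩ := hcomm d hd
    obtain ⟨g, hg, heg⟩ := hcomm e he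
    refine ⟨d * d' + A ^ 2 * (g * e'), add_mem (mul_mem hd hd') (mul_mem hA2 (mul_mem hg he')),
      f * e' + e * d', add_mem (mul_mem hf he') (mul_mem he hd'), ?_⟩
    have h₁ : d * (A * e') = A * (f * e') := by rw [← mul_assoc, hdf, mul_assoc]
    have h₂ : A * e * (A * e') = A ^ 2 * (g * e') := by
      rw [mul_assoc, ← mul_assoc e, heg, mul_assoc A g, ← mul_assoc A A, sq]
    rw [add_mul, mul_add, mul_add, h₁, h₂, mul_add, mul_assoc A e d']
    abel


/-- The quantum disc as the `ℤ₂`-fixed-point subalgebra of the equator Podleś sphere: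
in `P(S²_{q∞})` (a star-algebra generated by `A, B` with the equator sphere relations and
the stated linearly independent monomials), the fixed points of the reflection `r₁`
(`A ↦ -A`, `B ↦ B`) form exactly the star-subalgebra generated by `B`, and `B` satisfies
the quantum disc relation `BB* - q⁴B*B = (1-q⁴)·1` (i.e. `x := B*` satisfies the defining
relation of `P(D_{q⁴})`). -/
theorem stmt_3 {S : Type*} [Ring S] [Algebra ℂ S] [StarRing S] [StarModule ℂ S]
    (q : ℝ) (hq : 0 < q) (hq1 : q < 1)
    (A B : S)
    (hA : star A = A)
    (hBA : B * A = ((q : ℂ) ^ 2) • (A * B))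
    (hBsB : star B * B = -A ^ 2 + 1)
    (hBBs : B * star B = (-((q : ℂ) ^ 4)) • A ^ 2 + 1)
    (hgen : StarAlgebra.adjoin ℂ ({A, B} : Set S) = ⊤)
    (hli : LinearIndependent ℂ (fun m : (ℕ × ℕ) ⊕ (ℕ × ℕ) =>
      Sum.elim (fun kl : ℕ × ℕ => A ^ kl.1 * B ^ kl.2)
        (fun mn : ℕ × ℕ => A ^ mn.1 * (star B) ^ (mn.2 + 1)) m))
    (r₁ : S ≃⋆ₐ[ℂ] S) (hr₁A : r₁ A = -A) (hr₁B : r₁ B = B) :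
    {a : S | r₁ a = a} = (StarAlgebra.adjoin ℂ ({B} : Set S) : Set S) ∧
    B * star B - ((q : ℂ) ^ 4) • (star B * B) = ((1 - q ^ 4 : ℝ) : ℂ) • (1 : S) := by
  have hq0 : (q : ℂ) ^ 2 ≠ 0 := pow_ne_zero 2 (Complex.ofReal_ne_zero.mpr hq.ne')
  have hBmem : B ∈ StarAlgebra.adjoin ℂ ({B} : Set S) := StarAlgebra.self_mem_adjoin_singleton ℂ B
  have hA2 : A ^ 2 = 1 - star B * B := by rw [hBsB]; abel
  have hA2mem : A ^ 2 ∈ StarAlgebra.adjoin ℂ ({B} : Set S) := by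
    rw [hA2]
    exact sub_mem (one_mem _) (mul_mem (star_mem hBmem) hBmem)
  have hBsA : star B * A = ((q : ℂ) ^ 2)⁻¹ • (A * star B) := by
    have h := congrArg star hBA
    simp only [star_mul, star_smul, hA, star_pow, Complex.star_def, Complex.conj_ofReal] at h
    rw [h, smul_smul, inv_mul_cancel₀ hq0, one_smul]
  have hcomm : ∀ d ∈ StarAlgebra.adjoin ℂ ({B} : Set S),
      ∃ e ∈ StarAlgebra.adjoin ℂ ({B} : Set S), d * A = A * e := fun d hd =>
    exists_mul_eq_mul_of_mem_adjoin_singleton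
      ⟨(q : ℂ) ^ 2 • B, SMulMemClass.smul_mem _ hBmem, by rw [hBA, mul_smul_comm]⟩
      ⟨((q : ℂ) ^ 2)⁻¹ • star B, SMulMemClass.smul_mem _ (star_mem hBmem),
        by rw [hBsA, mul_smul_comm]⟩ hd
  have hfix : ∀ d ∈ StarAlgebra.adjoin ℂ ({B} : Set S), r₁ d = d := fun d hd =>
    StarAlgHom.adjoin_le_equalizer (r₁ : S →⋆ₐ[ℂ] S) (StarAlgHom.id ℂ S)
      (s := {B}) (by rintro _ rfl; exact hr₁B) hd
  refine ⟨Set.Subset.antisymm (fun a ha => ?_) hfix, ?_⟩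
  · obtain ⟨d, hd, e, he, rfl⟩ := exists_eq_add_mul_of_mem_adjoin_pair hA hA2mem hcomm
      (show a ∈ StarAlgebra.adjoin ℂ ({A, B} : Set S) by rw [hgen]; trivial)
    have h : -(A * e) = A * e := by
      simpa [hfix d hd, hfix e he, hr₁A] using ha
    have h0 : A * e = 0 := by
      have h2 : (2 : ℂ) • (A * e) = 0 := by
        rw [two_smul]
        nth_rewrite 1 [← h]
        exact neg_add_cancel _
      exact (smul_eq_zero_iff_right two_ne_zero).mp h2
    rw [h0, add_zero]
    exact hd
  · rw [hBBs, hBsB]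
    push_cast
    module
end

section
/- Let q ∈ (0,1) and let S be a unital complex star-algebra generated by elements A, B (and their stars) satisfying A* = A, BA = q²AB, B*B = −A² + 1, BB* = −q⁴A² + 1, such that the monomials A^k B^l (k,l ∈ ℕ) together with A^m (B*)^n (m ∈ ℕ, n ≥ 1) are ℂ-linearly independent in S and span S. Let r₁ : S → S be a star-algebra automorphism with r₁(A) = −A and r₁(B) = B. Then there do NOT exist finite families p_1,…,p_n and p'_1,…,p'_n in S with Σ_i p_i p'_i = 1 and Σ_i p_i r₁(p'_i) = −1. (Consequently the canonical Galois map of the ℤ₂-extension P(S²_{q∞}/ℤ₂) ⊆ P(S²_{q∞}) is not surjective, i.e., the extension is not Galois.) -/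
theorem pow_mul_eq_smul_mul_pow {R S : Type*} [CommSemiring R] [Semiring S] [Algebra R S]
    {a b : S} {c : R} (h : b * a = c • (a * b)) (n : ℕ) : b ^ n * a = c ^ n • (a * b ^ n) := by
  induction n with
  | zero => simp
  | succ n ih =>
    rw [pow_succ, mul_assoc, h, mul_smul_comm, ← mul_assoc, ih, smul_mul_assoc, smul_smul,
      mul_assoc, ← pow_succ, ← pow_succ']

/-- The `ℤ₂`-extension `P(S²_{q∞}/ℤ₂) ⊆ P(S²_{q∞})` is not Galois: in the polynomial
algebra of the equator Podleś quantum sphere (a star-algebra generated by `A, B` with the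
equator sphere relations, whose listed monomials form a linear basis), with the reflection
`r₁` (`A ↦ -A`, `B ↦ B`), there are no finite families `pᵢ, p'ᵢ` with `Σ pᵢ p'ᵢ = 1` and
`Σ pᵢ r₁(p'ᵢ) = -1`; hence the canonical Galois map is not surjective. -/
theorem stmt_4 {S : Type*} [Ring S] [Algebra ℂ S] [StarRing S] [StarModule ℂ S]
    (q : ℝ) (hq : 0 < q) (hq1 : q < 1)
    (A B : S)
    (hA : star A = A)
    (hBA : B * A = ((q : ℂ) ^ 2) • (A * B))
    (hBsB : star B * B = -A ^ 2 + 1)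
    (hBBs : B * star B = (-((q : ℂ) ^ 4)) • A ^ 2 + 1)
    (hli : LinearIndependent ℂ (fun m : (ℕ × ℕ) ⊕ (ℕ × ℕ) =>
      Sum.elim (fun kl : ℕ × ℕ => A ^ kl.1 * B ^ kl.2)
        (fun mn : ℕ × ℕ => A ^ mn.1 * (star B) ^ (mn.2 + 1)) m))
    (hspan : Submodule.span ℂ (Set.range (fun m : (ℕ × ℕ) ⊕ (ℕ × ℕ) =>
      Sum.elim (fun kl : ℕ × ℕ => A ^ kl.1 * B ^ kl.2)
        (fun mn : ℕ × ℕ => A ^ mn.1 * (star B) ^ (mn.2 + 1)) m)) = ⊤)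
    (r₁ : S ≃⋆ₐ[ℂ] S) (hr₁A : r₁ A = -A) (hr₁B : r₁ B = B) :
    ¬ ∃ (n : ℕ) (p p' : Fin n → S),
        (∑ i, p i * p' i) = 1 ∧ (∑ i, p i * r₁ (p' i)) = -1 := by
  have hAB : star B * A = (((q : ℂ) ^ 2)⁻¹) • (A * star B) := by
    have h := congrArg star hBA
    simp only [star_mul, star_smul, hA, star_pow, Complex.star_def, Complex.conj_ofReal] at h
    have hq0 : (q : ℂ) ^ 2 ≠ 0 := by simp [hq.ne']
    rw [h, smul_smul, inv_mul_cancel₀ hq0, one_smul]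
  set v : (ℕ × ℕ) ⊕ (ℕ × ℕ) → S := fun m =>
      Sum.elim (fun kl : ℕ × ℕ => A ^ kl.1 * B ^ kl.2)
        (fun mn : ℕ × ℕ => A ^ mn.1 * (star B) ^ (mn.2 + 1)) m with hv
  have hind : ∀ K : Submodule ℂ S, (∀ m, v m ∈ K) → ∀ x, x ∈ K := fun K hK x => by
    have : Submodule.span ℂ (Set.range v) ≤ K :=
      Submodule.span_le.2 (Set.range_subset_iff.2 hK)
    rw [hspan] at this
    exact this trivial
  let J : Submodule ℂ S := LinearMap.range (LinearMap.mulLeft ℂ A)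
  have hJ : ∀ y, A * y ∈ J := fun y => ⟨y, rfl⟩
  have hcomm : ∀ x, x * A ∈ J := by
    have hmon : ∀ (b : S) (c : ℂ), b * A = c • (A * b) → ∀ k l, A ^ k * b ^ l * A ∈ J := by
      intro b c h k l
      rw [mul_assoc, pow_mul_eq_smul_mul_pow h, mul_smul_comm, ← mul_assoc, ← pow_succ,
        pow_succ', mul_assoc]
      exact J.smul_mem _ (hJ _)
    refine hind (J.comap (LinearMap.mulRight ℂ A)) ?_
    rintro (⟨k, l⟩ | ⟨k, l⟩)
    · exact hmon _ _ hBA k l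
    · exact hmon _ _ hAB k (l + 1)
  have hmul : ∀ p, ∀ x ∈ J, p * x ∈ J := by
    rintro p _ ⟨y, rfl⟩
    obtain ⟨z, hz⟩ := hcomm p
    refine ⟨z * y, ?_⟩
    simp only [LinearMap.mulLeft_apply] at hz ⊢
    rw [← mul_assoc, hz, mul_assoc]
  have hodd : ∀ x, x - r₁ x ∈ J := by
    have hmon : ∀ b : S, r₁ b = b → ∀ k l, A ^ k * b ^ l - r₁ (A ^ k * b ^ l) ∈ J := by
      intro b hb k l
      rw [map_mul, map_pow, map_pow, hr₁A, hb]
      cases k with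
      | zero => simp
      | succ k =>
        rw [pow_succ' A, pow_succ' (-A), mul_assoc, mul_assoc, neg_mul]
        exact J.sub_mem (hJ _) (J.neg_mem (hJ _))
    have hr₁star : r₁ (star B) = star B := by rw [map_star, hr₁B]
    refine hind (J.comap (LinearMap.id - (r₁ : S →ₗ[ℂ] S))) ?_
    rintro (⟨k, l⟩ | ⟨k, l⟩)
    · exact hmon _ hr₁B k l
    · exact hmon _ hr₁star k (l + 1)
  have hone : (1 : S) ∉ J := by
    have hnot := hli.notMem_span_image (s := {Sum.inl (0, 0)}ᶜ) (x := Sum.inl (0, 0)) (by simp)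
    rintro ⟨y, hy⟩
    apply hnot
    have h1 : v (Sum.inl (0, 0)) = 1 := by simp [hv]
    rw [h1, ← hy]
    refine hind ((Submodule.span ℂ (v '' {Sum.inl (0, 0)}ᶜ)).comap
      (LinearMap.mulLeft ℂ A)) ?_ y
    rintro (⟨k, l⟩ | ⟨k, l⟩)
    · refine Submodule.subset_span ⟨Sum.inl (k + 1, l), by simp, ?_⟩
      simp [hv, pow_succ', mul_assoc]
    · refine Submodule.subset_span ⟨Sum.inr (k + 1, l), by simp, ?_⟩
      simp [hv, pow_succ', mul_assoc]
  rintro ⟨n, p, p', h1, h2⟩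
  have hsum : ∑ i, p i * (p' i - r₁ (p' i)) ∈ J :=
    J.sum_mem fun i _ => hmul _ _ (hodd _)
  simp only [mul_sub, Finset.sum_sub_distrib, h1, h2] at hsum
  apply hone
  have h3 := J.smul_mem (2⁻¹ : ℂ) hsum
  rwa [sub_neg_eq_add, ← two_smul ℂ (1 : S), smul_smul, inv_mul_cancel₀ two_ne_zero,
    one_smul] at h3
end

section
/- Let c ∈ (0,∞) and λ_+ := 1/2 + √(c + 1/4). For any two distinct positive natural numbers k₁ ≠ k₂, there exists q ∈ (0,1) such that q^{2k₁} + q^{2k₂} = 1/λ_+, and for this q one has c_+(k₁) = c_+(k₂), where c_+(k) := λ_+ q^{2k} − (λ_+ q^{2k})² + c. -/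
/-- The sequence `k ↦ c₊(k)` of squared weights of the shift `π^c_+(B_c)` can fail to be
injective: for `c > 0`, `λ₊ = 1/2 + √(c+1/4)`, and any distinct positive `k₁ ≠ k₂` there
is `q ∈ (0,1)` with `q^{2k₁} + q^{2k₂} = 1/λ₊`, and then `c₊(k₁) = c₊(k₂)`, where
`c₊(k) = λ₊ q^{2k} - (λ₊ q^{2k})² + c`. -/
theorem stmt_6 (c : ℝ) (hc : 0 < c) (k₁ k₂ : ℕ) (hk₁ : 0 < k₁) (hk₂ : 0 < k₂)
    (hne : k₁ ≠ k₂) :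
    ∃ q : ℝ, 0 < q ∧ q < 1 ∧
      q ^ (2 * k₁) + q ^ (2 * k₂) = 1 / (1 / 2 + Real.sqrt (c + 1 / 4)) ∧
      (1 / 2 + Real.sqrt (c + 1 / 4)) * q ^ (2 * k₁)
          - ((1 / 2 + Real.sqrt (c + 1 / 4)) * q ^ (2 * k₁)) ^ 2 + c
        = (1 / 2 + Real.sqrt (c + 1 / 4)) * q ^ (2 * k₂)
          - ((1 / 2 + Real.sqrt (c + 1 / 4)) * q ^ (2 * k₂)) ^ 2 + c := by
  have hl : 1 < 1 / 2 + Real.sqrt (c + 1 / 4) := by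
    have : (1 / 2 : ℝ) < Real.sqrt (c + 1 / 4) := Real.lt_sqrt_of_sq_lt (by linarith)
    linarith
  generalize 1 / 2 + Real.sqrt (c + 1 / 4) = l at hl ⊢
  have hl0 : 0 < l := by linarith
  have hinv : 1 / l < 1 := by rwa [div_lt_one hl0]
  have hcont : ContinuousOn (fun q : ℝ => q ^ (2 * k₁) + q ^ (2 * k₂)) (Set.Icc 0 1) := by
    fun_prop
  have hmem : 1 / l ∈ Set.Ioo ((0 : ℝ) ^ (2 * k₁) + 0 ^ (2 * k₂)) (1 ^ (2 * k₁) + 1 ^ (2 * k₂)) := by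
    rw [zero_pow (by omega), zero_pow (by omega), one_pow, one_pow]
    exact ⟨by rw [add_zero]; positivity, by linarith⟩
  obtain ⟨q, ⟨hq0, hq1⟩, hq⟩ := intermediate_value_Ioo zero_le_one hcont hmem
  refine ⟨q, hq0, hq1, hq, ?_⟩
  have hsum : l * q ^ (2 * k₁) + l * q ^ (2 * k₂) = 1 := by
    rw [← mul_add]
    exact (congrArg (l * ·) hq).trans (mul_one_div_cancel hl0.ne')
  linear_combination (l * q ^ (2 * k₂) - l * q ^ (2 * k₁)) * hsum
end

section
/- Let q ∈ (0,1) and let S be a unital complex star-algebra containing elements A, B with A* = A, BA = q²AB, B*B = −A² + 1, BB* = −q⁴A² + 1. Set P := A², R := B², T := AB. Then the following relations hold in S: P* = P; T² = q²PR; RT* = q²T(−q⁴P + 1); R*T = q^{−2}T*(−P + 1); RR* = q^{12}P² − q⁴(1+q⁴)P + 1; R*R = q^{−4}P² − (1+q^{−4})P + 1; TT* = −q⁴P² + P; T*T = q^{−4}(P − P²); RP = q⁸PR; RT = q⁴TR; PT = q^{−4}TP. -/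
/-- The defining relations of `P(ℝP²_q)` hold for `P := A²`, `R := B²`, `T := AB` in any
unital complex star-algebra whose elements `A, B` satisfy the defining relations of the
equator Podleś quantum sphere `P(S²_{q∞})`. -/
theorem stmt_8 {S : Type*} [Ring S] [Algebra ℂ S] [StarRing S] [StarModule ℂ S]
    (q : ℝ) (hq : 0 < q) (hq1 : q < 1)
    (A B : S)
    (hA : star A = A)
    (hBA : B * A = ((q : ℂ) ^ 2) • (A * B))
    (hBsB : star B * B = -A ^ 2 + 1)
    (hBBs : B * star B = (-((q : ℂ) ^ 4)) • A ^ 2 + 1)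
    (P R T : S) (hP : P = A ^ 2) (hR : R = B ^ 2) (hT : T = A * B) :
    star P = P ∧
    T ^ 2 = ((q : ℂ) ^ 2) • (P * R) ∧
    R * star T = ((q : ℂ) ^ 2) • (T * ((-((q : ℂ) ^ 4)) • P + 1)) ∧
    star R * T = (((q : ℂ) ^ 2)⁻¹) • (star T * (-P + 1)) ∧
    R * star R = ((q : ℂ) ^ 12) • P ^ 2 - ((q : ℂ) ^ 4 * (1 + (q : ℂ) ^ 4)) • P + 1 ∧
    star R * R = (((q : ℂ) ^ 4)⁻¹) • P ^ 2 - (1 + ((q : ℂ) ^ 4)⁻¹) • P + 1 ∧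
    T * star T = (-((q : ℂ) ^ 4)) • P ^ 2 + P ∧
    star T * T = (((q : ℂ) ^ 4)⁻¹) • (P - P ^ 2) ∧
    R * P = ((q : ℂ) ^ 8) • (P * R) ∧
    R * T = ((q : ℂ) ^ 4) • (T * R) ∧
    P * T = (((q : ℂ) ^ 4)⁻¹) • (T * P) := by
  have hc : (q : ℂ) ≠ 0 := by exact_mod_cast hq.ne'
  have hAs : star B * A = ((q : ℂ) ^ 2)⁻¹ • (A * star B) := by
    have h := congrArg star hBA
    simp only [star_mul, star_smul, hA, star_pow, RCLike.star_def, Complex.conj_ofReal] at h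
    rw [h, smul_smul, inv_mul_cancel₀ (pow_ne_zero 2 hc), one_smul]
  have hBA' (x : S) : B * (A * x) = ((q : ℂ) ^ 2) • (A * (B * x)) := by
    rw [← mul_assoc, hBA, smul_mul_assoc, mul_assoc]
  have hAs' (x : S) : star B * (A * x) = ((q : ℂ) ^ 2)⁻¹ • (A * (star B * x)) := by
    rw [← mul_assoc, hAs, smul_mul_assoc, mul_assoc]
  have hBsB' (x : S) : star B * (B * x) = -(A * (A * x)) + x := by
    rw [← mul_assoc, hBsB, add_mul, neg_mul, one_mul, pow_two, mul_assoc]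
  have hBBs' (x : S) : B * (star B * x) = (-((q : ℂ) ^ 4)) • (A * (A * x)) + x := by
    rw [← mul_assoc, hBBs, add_mul, smul_mul_assoc, one_mul, pow_two, mul_assoc]
  rw [pow_two] at hBsB hBBs
  subst hP hR hT
  refine ⟨by rw [star_pow, hA], ?_, ?_, ?_, ?_, ?_, ?_, ?_, ?_, ?_, ?_⟩
  all_goals
    simp only [pow_two A, pow_two B, pow_two (A * B), pow_two (A * A), star_mul, hA, mul_assoc,
      hBA, hBA', hAs, hAs', hBsB, hBsB', hBBs, hBBs', mul_add, mul_one, mul_neg, mul_smul_comm, smul_mul_assoc,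
      smul_add, smul_neg, smul_smul]
    try match_scalars <;> field_simp <;> ring
end

section
/- Let q ∈ (0,1) and let S be a unital complex star-algebra containing elements P, R, T satisfying P* = P, T² = q²PR, RT* = q²T(−q⁴P + 1), R*T = q^{−2}T*(−P + 1), RR* = q^{12}P² − q⁴(1+q⁴)P + 1, R*R = q^{−4}P² − (1+q^{−4})P + 1, TT* = −q⁴P² + P, T*T = q^{−4}(P − P²), RP = q⁸PR, RT = q⁴TR, PT = q^{−4}TP. Then the smallest star-subalgebra of S containing P, R, T equals the ℂ-linear span of the elements P^k R^l, P^k T R^l, P^m (R*)^{n+1}, P^m T* (R*)^n, for k, l, m, n ∈ ℕ (together with 1 = P^0R^0). -/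
/-- If left multiplication by `P` preserves `V` and `g` commutes with `P` up to a scalar, then
`g * w ∈ V` implies `g * (P ^ k * w) ∈ V`. -/
theorem mul_pow_mul_mem_of_skew_commute {A S : Type*} [CommSemiring A] [Semiring S] [Algebra A S]
    {V : Submodule A S} {P g w : S} {c : A} (hP : ∀ v ∈ V, P * v ∈ V)
    (hg : g * P = c • (P * g)) (hw : g * w ∈ V) (k : ℕ) : g * (P ^ k * w) ∈ V := by
  induction k with
  | zero => simpa using hw
  | succ k ih =>
    have h : g * (P ^ (k + 1) * w) = c • (P * (g * (P ^ k * w))) := by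
      rw [pow_succ', mul_assoc, ← mul_assoc g, hg, smul_mul_assoc, mul_assoc]
    rw [h]
    exact V.smul_mem c (hP _ ih)

/-- A submodule preserved by left multiplication by every element of a set is preserved by left
multiplication by the subalgebra generated by that set. -/
theorem mul_mem_of_mem_algebra_adjoin {A S : Type*} [CommSemiring A] [Semiring S] [Algebra A S]
    {V : Submodule A S} {s : Set S} (hs : ∀ g ∈ s, ∀ v ∈ V, g * v ∈ V) {x : S}
    (hx : x ∈ Algebra.adjoin A s) : ∀ v ∈ V, x * v ∈ V := by
  induction hx using Algebra.adjoin_induction with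
  | mem g hg => exact hs g hg
  | algebraMap r =>
    intro v hv
    rw [← Algebra.smul_def]
    exact V.smul_mem r hv
  | add x y _ _ hx hy =>
    intro v hv
    rw [add_mul]
    exact V.add_mem (hx v hv) (hy v hv)
  | mul x y _ _ hx hy =>
    intro v hv
    rw [mul_assoc]
    exact hx _ (hy v hv)


/-- Spanning of `P(ℝP²_q)` by the standard monomials: if `P, R, T` in a unital complex
star-algebra satisfy the defining relations of quantum real projective space, then the
smallest star-subalgebra containing `P, R, T` equals the linear span of the elements
`P^k R^l`, `P^k T R^l`, `P^m (R*)^(n+1)`, `P^m T* (R*)^n` (`k,l,m,n ∈ ℕ`). -/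
theorem stmt_9 {S : Type*} [Ring S] [Algebra ℂ S] [StarRing S] [StarModule ℂ S]
    (q : ℝ) (hq : 0 < q) (hq1 : q < 1)
    (P R T : S)
    (h1 : star P = P)
    (h2 : T ^ 2 = ((q : ℂ) ^ 2) • (P * R))
    (h3 : R * star T = ((q : ℂ) ^ 2) • (T * ((-((q : ℂ) ^ 4)) • P + 1)))
    (h4 : star R * T = (((q : ℂ) ^ 2)⁻¹) • (star T * (-P + 1)))
    (h5 : R * star R = ((q : ℂ) ^ 12) • P ^ 2 - ((q : ℂ) ^ 4 * (1 + (q : ℂ) ^ 4)) • P + 1)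
    (h6 : star R * R = (((q : ℂ) ^ 4)⁻¹) • P ^ 2 - (1 + ((q : ℂ) ^ 4)⁻¹) • P + 1)
    (h7 : T * star T = (-((q : ℂ) ^ 4)) • P ^ 2 + P)
    (h8 : star T * T = (((q : ℂ) ^ 4)⁻¹) • (P - P ^ 2))
    (h9 : R * P = ((q : ℂ) ^ 8) • (P * R))
    (h10 : R * T = ((q : ℂ) ^ 4) • (T * R))
    (h11 : P * T = (((q : ℂ) ^ 4)⁻¹) • (T * P)) :
    (StarAlgebra.adjoin ℂ ({P, R, T} : Set S) : Set S) =
      (Submodule.span ℂ (Set.range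
        (fun m : (ℕ × ℕ) ⊕ (ℕ × ℕ) ⊕ (ℕ × ℕ) ⊕ (ℕ × ℕ) =>
          match m with
          | .inl (k, l) => P ^ k * R ^ l
          | .inr (.inl (k, l)) => P ^ k * T * R ^ l
          | .inr (.inr (.inl (m, n))) => P ^ m * (star R) ^ (n + 1)
          | .inr (.inr (.inr (m, n))) => P ^ m * star T * (star R) ^ n)) : Set S) := by
  have hq0 : (q : ℂ) ≠ 0 := by exact_mod_cast hq.ne'
  have hTP : T * P = ((q : ℂ) ^ 4) • (P * T) := by
    rw [h11, smul_inv_smul₀ (pow_ne_zero _ hq0)]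
  have hR'P : star R * P = (((q : ℂ) ^ 8)⁻¹) • (P * star R) := by
    have h := congrArg star h9
    simp only [star_mul, star_smul, h1, star_pow, Complex.star_def, Complex.conj_ofReal] at h
    rw [h, inv_smul_smul₀ (pow_ne_zero _ hq0)]
  have hT'P : star T * P = (((q : ℂ) ^ 4)⁻¹) • (P * star T) := by
    simpa [h1] using congrArg star h11
  have hTR' : T * star R = ((q : ℂ) ^ 2) • ((-((q : ℂ) ^ 4) • P + 1) * star T) := by
    simpa [h1] using congrArg star h3
  have hT'R : star T * R = (((q : ℂ) ^ 2)⁻¹) • ((-P + 1) * T) := by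
    simpa [h1] using congrArg star h4
  have hR'T' : star R * star T = (((q : ℂ) ^ 4)⁻¹) • (star T * star R) := by
    have h := congrArg star h10
    simp only [star_mul, star_smul, star_pow, Complex.star_def, Complex.conj_ofReal] at h
    rw [h, inv_smul_smul₀ (pow_ne_zero _ hq0)]
  have hT'T' : star T * star T = ((q : ℂ) ^ 2) • (star R * P) := by
    simpa [h1, pow_two] using congrArg star h2
  set f : (ℕ × ℕ) ⊕ (ℕ × ℕ) ⊕ (ℕ × ℕ) ⊕ (ℕ × ℕ) → S := fun m =>
    match m with
    | .inl (k, l) => P ^ k * R ^ l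
    | .inr (.inl (k, l)) => P ^ k * T * R ^ l
    | .inr (.inr (.inl (m, n))) => P ^ m * (star R) ^ (n + 1)
    | .inr (.inr (.inr (m, n))) => P ^ m * star T * (star R) ^ n with hf
  set V := Submodule.span ℂ (Set.range f) with hV
  have ha (k l : ℕ) : P ^ k * R ^ l ∈ V := Submodule.subset_span ⟨.inl (k, l), rfl⟩
  have hb (k l : ℕ) : P ^ k * (T * R ^ l) ∈ V :=
    Submodule.subset_span ⟨.inr (.inl (k, l)), mul_assoc _ _ _⟩
  have hc (k l : ℕ) : P ^ k * star R ^ l ∈ V := by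
    cases l with
    | zero => simpa using ha k 0
    | succ l => exact Submodule.subset_span ⟨.inr (.inr (.inl (k, l))), rfl⟩
  have hd (k l : ℕ) : P ^ k * (star T * star R ^ l) ∈ V :=
    Submodule.subset_span ⟨.inr (.inr (.inr (k, l))), mul_assoc _ _ _⟩
  have ind (g : S) (hga : ∀ k l, g * (P ^ k * R ^ l) ∈ V)
      (hgb : ∀ k l, g * (P ^ k * (T * R ^ l)) ∈ V)
      (hgc : ∀ k l, g * (P ^ k * star R ^ l) ∈ V)
      (hgd : ∀ k l, g * (P ^ k * (star T * star R ^ l)) ∈ V) : ∀ v ∈ V, g * v ∈ V := by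
    intro v hv
    induction hv using Submodule.span_induction with
    | mem x hx =>
      obtain ⟨⟨k, l⟩ | ⟨k, l⟩ | ⟨k, l⟩ | ⟨k, l⟩, rfl⟩ := hx
      · exact hga k l
      · simpa only [hf, mul_assoc] using hgb k l
      · exact hgc k (l + 1)
      · simpa only [hf, mul_assoc] using hgd k l
    | zero => simp
    | add x y _ _ hx hy => rw [mul_add]; exact V.add_mem hx hy
    | smul c x _ hx => rw [mul_smul_comm]; exact V.smul_mem c hx
  have hP : ∀ v ∈ V, P * v ∈ V := by
    refine ind P ?_ ?_ ?_ ?_ <;> intro k l <;> rw [← mul_assoc, ← pow_succ']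
    exacts [ha _ _, hb _ _, hc _ _, hd _ _]
  have hPP (w : S) (hw : w ∈ V) : P ^ 2 * w ∈ V := by
    rw [pow_two, mul_assoc]
    exact hP _ (hP _ hw)
  have ha0 (l : ℕ) : R ^ l ∈ V := by simpa using ha 0 l
  have hb0 (l : ℕ) : T * R ^ l ∈ V := by simpa using hb 0 l
  have hc0 (l : ℕ) : star R ^ l ∈ V := by simpa using hc 0 l
  have hd0 (l : ℕ) : star T * star R ^ l ∈ V := by simpa using hd 0 l
  have hlin (a : ℂ) (w : S) (hw : w ∈ V) : (a • P + 1) * w ∈ V := by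
    rw [add_mul, one_mul, smul_mul_assoc]
    exact V.add_mem (V.smul_mem _ (hP _ hw)) hw
  have hlin' (w : S) (hw : w ∈ V) : (-P + 1) * w ∈ V := by
    simpa using hlin (-1) w hw
  have hquad (a b : ℂ) (w : S) (hw : w ∈ V) : (a • P ^ 2 - b • P + 1) * w ∈ V := by
    rw [add_mul, sub_mul, one_mul, smul_mul_assoc, smul_mul_assoc]
    exact V.add_mem (V.sub_mem (V.smul_mem _ (hPP _ hw)) (V.smul_mem _ (hP _ hw))) hw
  have hTR'n (n : ℕ) : T * star R ^ n ∈ V := by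
    cases n with
    | zero => simpa using hb0 0
    | succ n =>
      rw [pow_succ', ← mul_assoc, hTR', smul_mul_assoc, mul_assoc]
      exact V.smul_mem _ (hlin _ _ (hd0 n))
  have hT'Rn (n : ℕ) : star T * R ^ n ∈ V := by
    cases n with
    | zero => simpa using hd0 0
    | succ n =>
      rw [pow_succ', ← mul_assoc, hT'R, smul_mul_assoc, mul_assoc]
      exact V.smul_mem _ (hlin' _ (hb0 n))
  have skew (g : S) (c : ℂ) (hg : g * P = c • (P * g)) (hga : ∀ l, g * R ^ l ∈ V)
      (hgb : ∀ l, g * (T * R ^ l) ∈ V) (hgc : ∀ l, g * star R ^ l ∈ V)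
      (hgd : ∀ l, g * (star T * star R ^ l) ∈ V) : ∀ v ∈ V, g * v ∈ V :=
    ind g (fun k l => mul_pow_mul_mem_of_skew_commute hP hg (hga l) k)
      (fun k l => mul_pow_mul_mem_of_skew_commute hP hg (hgb l) k)
      (fun k l => mul_pow_mul_mem_of_skew_commute hP hg (hgc l) k)
      (fun k l => mul_pow_mul_mem_of_skew_commute hP hg (hgd l) k)
  have hT : ∀ v ∈ V, T * v ∈ V := by
    refine skew T _ hTP hb0 (fun l => ?_) hTR'n (fun l => ?_)
    · rw [← mul_assoc, ← pow_two, h2, smul_mul_assoc, mul_assoc, ← pow_succ']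
      exact V.smul_mem _ (hP _ (ha0 _))
    · rw [← mul_assoc, h7, add_mul, smul_mul_assoc]
      exact V.add_mem (V.smul_mem _ (hPP _ (hc0 l))) (hP _ (hc0 l))
  have hT' : ∀ v ∈ V, star T * v ∈ V := by
    refine skew (star T) _ hT'P hT'Rn (fun l => ?_) hd0 (fun l => ?_)
    · rw [← mul_assoc, h8, smul_mul_assoc, sub_mul]
      exact V.smul_mem _ (V.sub_mem (hP _ (ha0 l)) (hPP _ (ha0 l)))
    · rw [← mul_assoc, hT'T', hR'P, smul_mul_assoc, smul_mul_assoc, mul_assoc, ← pow_succ']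
      exact V.smul_mem _ (V.smul_mem _ (hP _ (hc0 _)))
  have hR : ∀ v ∈ V, R * v ∈ V := by
    refine skew R _ h9 (fun l => ?_) (fun l => ?_) (fun l => ?_) (fun l => ?_)
    · rw [← pow_succ']
      exact ha0 _
    · rw [← mul_assoc, h10, smul_mul_assoc, mul_assoc, ← pow_succ']
      exact V.smul_mem _ (hb0 _)
    · cases l with
      | zero => simpa using ha0 1
      | succ l =>
        rw [pow_succ', ← mul_assoc, h5]
        exact hquad _ _ _ (hc0 l)
    · rw [← mul_assoc, h3, smul_mul_assoc, mul_assoc]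
      exact V.smul_mem _ (hT _ (hlin _ _ (hc0 l)))
  have hR' : ∀ v ∈ V, star R * v ∈ V := by
    refine skew (star R) _ hR'P (fun l => ?_) (fun l => ?_) (fun l => ?_) (fun l => ?_)
    · cases l with
      | zero => simpa using hc0 1
      | succ l =>
        rw [pow_succ', ← mul_assoc, h6]
        exact hquad _ _ _ (ha0 l)
    · rw [← mul_assoc, h4, smul_mul_assoc, mul_assoc]
      exact V.smul_mem _ (hT' _ (hlin' _ (ha0 l)))
    · rw [← pow_succ']
      exact hc0 _
    · rw [← mul_assoc, hR'T', smul_mul_assoc, mul_assoc, ← pow_succ']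
      exact V.smul_mem _ (hd0 _)
  apply Set.Subset.antisymm
  · intro x hx
    have hx' : x ∈ Algebra.adjoin ℂ (({P, R, T} : Set S) ∪ star {P, R, T}) := hx
    have hmem : ∀ g ∈ ({P, R, T} : Set S) ∪ star {P, R, T}, ∀ v ∈ V, g * v ∈ V := by
      rintro g ((rfl | rfl | rfl) | (hg | hg | hg))
      · exact hP
      · exact hR
      · exact hT
      · rwa [← star_star g, hg, h1]
      · rwa [← star_star g, hg]
      · rwa [← star_star g, hg]
    simpa using mul_mem_of_mem_algebra_adjoin hmem hx' 1 (by simpa using ha0 0)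
  · have hsub := StarAlgebra.subset_adjoin ℂ ({P, R, T} : Set S)
    have hPm : P ∈ StarAlgebra.adjoin ℂ ({P, R, T} : Set S) := hsub (by simp)
    have hRm : R ∈ StarAlgebra.adjoin ℂ ({P, R, T} : Set S) := hsub (by simp)
    have hTm : T ∈ StarAlgebra.adjoin ℂ ({P, R, T} : Set S) := hsub (by simp)
    change V ≤ Subalgebra.toSubmodule (StarAlgebra.adjoin ℂ ({P, R, T} : Set S)).toSubalgebra
    rw [hV, Submodule.span_le]
    rintro _ ⟨⟨k, l⟩ | ⟨k, l⟩ | ⟨k, l⟩ | ⟨k, l⟩, rfl⟩ <;>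
      change _ ∈ StarAlgebra.adjoin ℂ ({P, R, T} : Set S)
    · exact mul_mem (pow_mem hPm k) (pow_mem hRm l)
    · exact mul_mem (mul_mem (pow_mem hPm k) hTm) (pow_mem hRm l)
    · exact mul_mem (pow_mem hPm k) (pow_mem (star_mem hRm) (l + 1))
    · exact mul_mem (mul_mem (pow_mem hPm k) (star_mem hTm)) (pow_mem (star_mem hRm) l)
end

section
/- Let q ∈ (0,1). On H = ℓ²(ℕ,ℂ) with orthonormal basis (e_k)_{k∈ℕ}, define bounded operators: P e_k = q^{4k} e_k; T e_0 = 0 and T e_k = q^{2(k−1)}(1 − q^{4k})^{1/2} e_{k−1} for k ≥ 1; R e_0 = R e_1 = 0 and R e_k = (1 − q^{4k})^{1/2}(1 − q^{4(k−1)})^{1/2} e_{k−2} for k ≥ 2. Then the adjoints satisfy T* e_k = q^{2k}(1 − q^{4(k+1)})^{1/2} e_{k+1} and R* e_k = (1 − q^{4(k+1)})^{1/2}(1 − q^{4(k+2)})^{1/2} e_{k+2}, P is self-adjoint, and the following relations hold: T² = q²PR, RT* = q²T(1 − q⁴P), R*T = q^{−2}T*(1 − P), RR* = q^{12}P² − q⁴(1+q⁴)P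 + 1, R*R = q^{−4}P² − (1+q^{−4})P + 1, TT* = −q⁴P² + P, T*T = q^{−4}(P − P²), RP = q⁸PR, RT = q⁴TR, PT = q^{−4}TP. -/
/-- Continuous linear maps that agree on a Hilbert basis are equal. -/
theorem HilbertBasis.clm_ext {ι 𝕜 E F : Type*} [RCLike 𝕜] [NormedAddCommGroup E]
    [InnerProductSpace 𝕜 E] [NormedAddCommGroup F] [NormedSpace 𝕜 F]
    (e : HilbertBasis ι 𝕜 E) {A B : E →L[𝕜] F} (h : ∀ i, A (e i) = B (e i)) : A = B := by
  refine ContinuousLinearMap.ext_on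
    (Submodule.dense_iff_topologicalClosure_eq_top.mpr e.dense_span) ?_
  rintro _ ⟨i, rfl⟩
  exact h i

/-- Vectors with the same coefficients in a Hilbert basis are equal. -/
theorem HilbertBasis.ext_inner {ι 𝕜 E : Type*} [RCLike 𝕜] [NormedAddCommGroup E]
    [InnerProductSpace 𝕜 E] (e : HilbertBasis ι 𝕜 E) {x y : E}
    (h : ∀ i, inner 𝕜 (e i) x = inner 𝕜 (e i) y) : x = y := by
  apply e.repr.injective
  ext i
  simpa only [e.repr_apply_apply] using h i

/-- The adjoint of a weighted backward shift by `n` with real weights is the weighted forward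
shift by `n` with the same weights. -/
theorem HilbertBasis.adjoint_backwardShift {𝕜 E : Type*} [RCLike 𝕜] [NormedAddCommGroup E]
    [InnerProductSpace 𝕜 E] [CompleteSpace E] (e : HilbertBasis ℕ 𝕜 E) {A : E →L[𝕜] E} {n : ℕ}
    {c : ℕ → ℝ} (h₀ : ∀ j < n, A (e j) = 0) (h : ∀ k, A (e (k + n)) = (c k : 𝕜) • e k) (k : ℕ) :
    ContinuousLinearMap.adjoint A (e k) = (c k : 𝕜) • e (k + n) := by
  refine e.ext_inner fun j => ?_
  have orth := orthonormal_iff_ite.mp e.orthonormal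
  rw [ContinuousLinearMap.adjoint_inner_right, inner_smul_right, orth]
  rcases lt_or_ge j n with hj | hj
  · rw [h₀ j hj, inner_zero_left, ite_cond_eq_false _ _ (by simp; omega), mul_zero]
  · obtain ⟨i, rfl⟩ := Nat.exists_eq_add_of_le' hj
    rw [h, inner_smul_left, orth, RCLike.conj_ofReal]
    by_cases hik : i = k <;> simp [hik]

open ContinuousLinearMap in
/-- The infinite-dimensional irreducible `*`-representation `ρ` of `P(ℝP²_q)`: the
weighted shifts `P, T, R` on `ℓ²(ℕ)` have the stated adjoints, `P` is self-adjoint, and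
they satisfy all the defining relations of quantum real projective space. -/
theorem stmt_11 {H : Type*} [NormedAddCommGroup H] [InnerProductSpace ℂ H] [CompleteSpace H]
    (e : HilbertBasis ℕ ℂ H) (q : ℝ) (hq : 0 < q) (hq1 : q < 1)
    (P T R : H →L[ℂ] H)
    (hP : ∀ k : ℕ, P (e k) = ((q ^ (4 * k) : ℝ) : ℂ) • e k)
    (hT0 : T (e 0) = 0)
    (hT : ∀ k : ℕ, T (e (k + 1))
      = ((q ^ (2 * k) * Real.sqrt (1 - q ^ (4 * (k + 1))) : ℝ) : ℂ) • e k)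
    (hR0 : R (e 0) = 0) (hR1 : R (e 1) = 0)
    (hR : ∀ k : ℕ, R (e (k + 2))
      = ((Real.sqrt (1 - q ^ (4 * (k + 2))) * Real.sqrt (1 - q ^ (4 * (k + 1))) : ℝ) : ℂ)
          • e k) :
    (∀ k : ℕ, (adjoint T) (e k)
      = ((q ^ (2 * k) * Real.sqrt (1 - q ^ (4 * (k + 1))) : ℝ) : ℂ) • e (k + 1)) ∧
    (∀ k : ℕ, (adjoint R) (e k)
      = ((Real.sqrt (1 - q ^ (4 * (k + 1))) * Real.sqrt (1 - q ^ (4 * (k + 2))) : ℝ) : ℂ)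
          • e (k + 2)) ∧
    IsSelfAdjoint P ∧
    T ^ 2 = ((q : ℂ) ^ 2) • (P * R) ∧
    R * adjoint T = ((q : ℂ) ^ 2) • (T * (1 - ((q : ℂ) ^ 4) • P)) ∧
    adjoint R * T = (((q : ℂ) ^ 2)⁻¹) • (adjoint T * (1 - P)) ∧
    R * adjoint R = ((q : ℂ) ^ 12) • P ^ 2 - ((q : ℂ) ^ 4 * (1 + (q : ℂ) ^ 4)) • P + 1 ∧
    adjoint R * R = (((q : ℂ) ^ 4)⁻¹) • P ^ 2 - (1 + ((q : ℂ) ^ 4)⁻¹) • P + 1 ∧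
    T * adjoint T = (-((q : ℂ) ^ 4)) • P ^ 2 + P ∧
    adjoint T * T = (((q : ℂ) ^ 4)⁻¹) • (P - P ^ 2) ∧
    R * P = ((q : ℂ) ^ 8) • (P * R) ∧
    R * T = ((q : ℂ) ^ 4) • (T * R) ∧
    P * T = (((q : ℂ) ^ 4)⁻¹) • (T * P) := by
  have hq0 : (q : ℂ) ≠ 0 := by exact_mod_cast hq.ne'
  have hTa (k : ℕ) : (adjoint T) (e k)
      = ((q ^ (2 * k) * Real.sqrt (1 - q ^ (4 * (k + 1))) : ℝ) : ℂ) • e (k + 1) :=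
    e.adjoint_backwardShift (by simpa using hT0) hT k
  have hRa (k : ℕ) : (adjoint R) (e k)
      = ((Real.sqrt (1 - q ^ (4 * (k + 1))) * Real.sqrt (1 - q ^ (4 * (k + 2))) : ℝ) : ℂ)
          • e (k + 2) := by
    rw [mul_comm]
    exact e.adjoint_backwardShift (by intro j hj; interval_cases j <;> assumption) hR k
  have hPa (k : ℕ) : (adjoint P) (e k) = ((q ^ (4 * k) : ℝ) : ℂ) • e k :=
    e.adjoint_backwardShift (n := 0) (by simp) hP k
  obtain ⟨s, hs⟩ : ∃ s : ℕ → ℂ, ∀ k, s k = ((Real.sqrt (1 - q ^ (4 * k)) : ℝ) : ℂ) :=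
    ⟨_, fun _ => rfl⟩
  have hs2 (k : ℕ) : s k ^ 2 = 1 - (q : ℂ) ^ (4 * k) := by
    have : Real.sqrt (1 - q ^ (4 * k)) ^ 2 = 1 - q ^ (4 * k) :=
      Real.sq_sqrt (sub_nonneg.mpr (pow_le_one₀ hq.le hq1.le))
    rw [hs]
    exact_mod_cast congrArg (fun x : ℝ => (x : ℂ)) this
  refine ⟨hTa, hRa, ?_, ?_⟩
  · rw [ContinuousLinearMap.isSelfAdjoint_iff']
    exact e.clm_ext fun k => by rw [hPa, hP]
  simp only [Complex.ofReal_mul, Complex.ofReal_pow, ← hs] at hP hT hR hTa hRa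
  have hP0 : P (e 0) = e 0 := by simpa using hP 0
  refine ⟨?_, ?_, ?_, ?_, ?_, ?_, ?_, ?_, ?_, ?_⟩ <;> refine e.clm_ext fun k => ?_ <;>
    simp only [pow_two P, pow_two T, mul_apply_eq_comp, _root_.smul_apply, _root_.sub_apply,
      _root_.add_apply, one_apply_eq_self]
  · rcases k with _ | _ | k
    · simp [hT0, hR0]
    · simp [hT0, hT, hR1]
    · simp only [hP, hT, hR, map_smul, add_assoc, Nat.reduceAdd]
      match_scalars
      field_simp
      ring
  · rcases k with _ | k
    · simp [hP, hT0, hR1, hTa]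
    · simp only [hP, hT, hR, hTa, map_smul, map_sub, add_assoc, Nat.reduceAdd]
      match_scalars
      ring_nf
      simp only [hs2]
      field_simp
      ring
  · rcases k with _ | k
    · simp [hP, hT0]
    · simp only [hP, hT, hTa, hRa, map_smul, map_sub, add_assoc, Nat.reduceAdd]
      match_scalars
      ring_nf
      simp only [hs2]
      field_simp
      ring
  · simp only [hP, hR, hRa, map_smul]
    match_scalars
    ring_nf
    simp only [hs2]
    field_simp
    ring
  · rcases k with _ | _ | k
    · simp only [hP0, hR0, map_zero]
      match_scalars
      field_simp
      ring
    · simp only [hR1, hP, map_smul, map_zero, zero_add]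
      match_scalars
      field_simp
      ring
    · simp only [hP, hR, hRa, map_smul, add_assoc, Nat.reduceAdd]
      match_scalars
      ring_nf
      simp only [hs2]
      field_simp
      ring
  · simp only [hP, hT, hTa, map_smul]
    match_scalars
    ring_nf
    simp only [hs2]
    field_simp
    ring
  · rcases k with _ | k
    · simp only [hP0, hT0, map_zero, smul_zero, sub_self]
    · simp only [hP, hT, hTa, map_smul]
      match_scalars
      ring_nf
      simp only [hs2]
      field_simp
      ring
  · rcases k with _ | _ | k
    · simp [hP, hR0]
    · simp [hP, hR1]
    · simp only [hP, hR, map_smul, add_assoc, Nat.reduceAdd]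
      match_scalars
      field_simp
      ring
  · rcases k with _ | _ | _ | k
    · simp [hT0, hR0]
    · simp [hT, hR0, hR1]
    · simp [hT0, hT, hR1, hR]
    · simp only [hT, hR, map_smul, add_assoc, Nat.reduceAdd]
      match_scalars
      field_simp
      ring
  · rcases k with _ | k
    · simp [hP, hT0]
    · simp only [hP, hT, map_smul]
      match_scalars
      field_simp
      ring
end

section
/- Let q ∈ (0,1), let A be a unital C*-algebra, and let P, T ∈ A with P self-adjoint and q⁴·T*T = P − P². Then P − P² ≥ 0, the spectrum of P is contained in [0,1] (in particular ‖P‖ ≤ 1), and ‖T‖² ≤ q^{−4}‖P − P²‖ ≤ q^{−4}/4. -/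
/-- The continuous functional calculus of a self-adjoint element at `x ↦ x - x ^ 2`. -/
theorem IsSelfAdjoint.cfc_sub_sq {A : Type*} [CStarAlgebra A] {a : A} (ha : IsSelfAdjoint a) :
    cfc (fun x : ℝ => x - x ^ 2) a = a - a ^ 2 := by
  rw [cfc_sub (fun x : ℝ => x) (fun x : ℝ => x ^ 2) a, cfc_id' ℝ a, cfc_pow_id a 2]

/-- A self-adjoint element `a` with `0 ≤ a - a ^ 2` has its spectrum in the unit interval. -/
theorem IsSelfAdjoint.spectrum_subset_Icc_of_sub_sq_nonneg {A : Type*} [CStarAlgebra A]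
    [PartialOrder A] [StarOrderedRing A] {a : A} (ha : IsSelfAdjoint a) (h : 0 ≤ a - a ^ 2) :
    spectrum ℝ a ⊆ Set.Icc (0 : ℝ) 1 := by
  rw [← ha.cfc_sub_sq, cfc_nonneg_iff (fun x : ℝ => x - x ^ 2) a] at h
  intro x hx
  have hx' : 0 ≤ x - x ^ 2 := h x hx
  constructor <;> nlinarith

/-- A self-adjoint element with spectrum in the unit interval has norm at most one. -/
theorem IsSelfAdjoint.norm_le_one_of_spectrum_subset_Icc {A : Type*} [CStarAlgebra A]
    {a : A} (ha : IsSelfAdjoint a) (h : spectrum ℝ a ⊆ Set.Icc (0 : ℝ) 1) : ‖a‖ ≤ 1 := by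
  rw [← cfc_id' ℝ a]
  refine norm_cfc_le zero_le_one fun x hx => ?_
  rw [Real.norm_eq_abs, abs_le]
  exact ⟨by linarith [(h hx).1], (h hx).2⟩

/-- If the spectrum of a self-adjoint `a` lies in the unit interval, `‖a - a ^ 2‖ ≤ 1 / 4`. -/
theorem IsSelfAdjoint.norm_sub_sq_le {A : Type*} [CStarAlgebra A]
    {a : A} (ha : IsSelfAdjoint a) (h : spectrum ℝ a ⊆ Set.Icc (0 : ℝ) 1) :
    ‖a - a ^ 2‖ ≤ 1 / 4 := by
  rw [← ha.cfc_sub_sq]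
  refine norm_cfc_le (by norm_num) fun x hx => ?_
  obtain ⟨h0, h1⟩ := h hx
  rw [Real.norm_eq_abs, abs_le]
  constructor <;> nlinarith [sq_nonneg (x - 1 / 2)]


/-- `P(ℝP²_q)` has no unbounded `*`-representations: in any unital C*-algebra, elements
`P, T` with `P* = P` and `q⁴ T*T = P - P²` automatically satisfy `P - P² ≥ 0`,
`Sp(P) ⊆ [0,1]` (so `‖P‖ ≤ 1`), and `‖T‖² ≤ q⁻⁴‖P - P²‖ ≤ q⁻⁴/4`. -/
theorem stmt_12 {A : Type*} [CStarAlgebra A] [PartialOrder A] [StarOrderedRing A]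
    (q : ℝ) (hq : 0 < q) (hq1 : q < 1)
    (P T : A)
    (hP : IsSelfAdjoint P)
    (hrel : ((q : ℂ) ^ 4) • (star T * T) = P - P ^ 2) :
    0 ≤ P - P ^ 2 ∧
    spectrum ℝ P ⊆ Set.Icc (0 : ℝ) 1 ∧
    ‖P‖ ≤ 1 ∧
    ‖T‖ ^ 2 ≤ (q ^ 4)⁻¹ * ‖P - P ^ 2‖ ∧
    (q ^ 4)⁻¹ * ‖P - P ^ 2‖ ≤ (q ^ 4)⁻¹ / 4 := by
  have hnonneg : 0 ≤ P - P ^ 2 := by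
    have h : star (((q : ℂ) ^ 2) • T) * (((q : ℂ) ^ 2) • T) = P - P ^ 2 := by
      rw [← hrel, star_smul, smul_mul_smul_comm]
      simp [← pow_add]
    exact h ▸ star_mul_self_nonneg _
  have hspec := hP.spectrum_subset_Icc_of_sub_sq_nonneg hnonneg
  have hq4 : 0 < q ^ 4 := by positivity
  refine ⟨hnonneg, hspec, hP.norm_le_one_of_spectrum_subset_Icc hspec, ?_, ?_⟩
  · rw [← hrel, norm_smul, CStarRing.norm_star_mul_self, norm_pow, Complex.norm_real,
      Real.norm_of_nonneg hq.le, inv_mul_cancel_left₀ hq4.ne', sq]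
  · rw [div_eq_mul_one_div (q ^ 4)⁻¹]
    gcongr
    exact hP.norm_sub_sq_le hspec
end

section
/- Let q ∈ (0,1), let H be a complex Hilbert space, and let P, T be bounded operators on H with P self-adjoint, 0 ≤ P ≤ 1, T ≠ 0, q⁴·T*T = P − P², and PT = q^{−4}TP. If λ lies in the spectrum of P and 0 < λ < 1, then q^{−4}λ also lies in the spectrum of P. -/
/-- A self-adjoint element of a star monoid that has a left inverse is invertible. -/
theorem IsSelfAdjoint.isUnit_of_mul_eq_one {R : Type*} [Monoid R] [StarMul R] {a b : R}
    (ha : IsSelfAdjoint a) (hab : b * a = 1) : IsUnit a := by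
  have h : a * star b = 1 := by simpa [ha.star_eq] using congrArg star hab
  have hb : b = star b := left_inv_eq_right_inv hab h
  exact ⟨⟨a, b, by rwa [← hb] at h, hab⟩, rfl⟩

/-- If `k S T = p - p²` and `p T = c T p` with `p` self-adjoint, then multiplication by `c` maps
the real spectral values of `p` other than `0` and `1` into the spectrum of `p`. -/
theorem IsSelfAdjoint.mul_mem_spectrum {A : Type*} [Ring A] [StarRing A] [Algebra ℂ A]
    [StarModule ℂ A] {p S T : A} (hp : IsSelfAdjoint p) {k c : ℂ}
    (hrel : k • (S * T) = p - p ^ 2) (hcom : p * T = c • (T * p))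
    {lam : ℝ} (h0 : lam ≠ 0) (h1 : lam ≠ 1) (hspec : (lam : ℂ) ∈ spectrum ℂ p) :
    c * lam ∈ spectrum ℂ p := by
  rw [spectrum.mem_iff] at hspec ⊢
  intro hu
  obtain ⟨R, hR⟩ := hu.exists_left_inv
  apply hspec
  set a : A := algebraMap ℂ A lam - p with ha
  have hlam : (lam : ℂ) * (1 - lam) ≠ 0 := by
    norm_cast
    exact mul_ne_zero h0 (sub_ne_zero.mpr h1.symm)
  have hsa : IsSelfAdjoint a := by
    refine IsSelfAdjoint.sub ?_ hp
    rw [IsSelfAdjoint, ← algebraMap_star_comm]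
    simp
  have hint : (algebraMap ℂ A (c * lam) - p) * T = c • (T * a) := by
    simp only [ha, sub_mul, mul_sub, hcom, Algebra.algebraMap_eq_smul_one, smul_sub, mul_smul,
      mul_smul_comm, smul_mul_assoc, one_mul, mul_one]
  have hT : T = c • (R * T * a) := by
    rw [mul_assoc R, ← mul_smul_comm, ← hint, ← mul_assoc, hR, one_mul]
  have hfactor : ((lam : ℂ) * (1 - lam)) • (1 : A) =
      ((k * c) • (S * R * T) + (1 - p - algebraMap ℂ A lam)) * a := by
    have hquad : p - p ^ 2 = ((k * c) • (S * R * T)) * a := by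
      rw [← hrel]
      conv_lhs => rw [hT]
      simp only [mul_smul_comm, smul_mul_assoc, smul_smul, mul_assoc]
    rw [add_mul, ← hquad, ha]
    simp only [Algebra.algebraMap_eq_smul_one, sub_mul, mul_sub, mul_smul_comm, smul_mul_assoc,
      one_mul, mul_one, sq]
    module
  refine hsa.isUnit_of_mul_eq_one (b := ((lam : ℂ) * (1 - lam))⁻¹ •
    ((k * c) • (S * R * T) + (1 - p - algebraMap ℂ A lam))) ?_
  rw [smul_mul_assoc, ← hfactor, smul_smul, inv_mul_cancel₀ hlam, one_smul]

open ContinuousLinearMap in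
/-- Spectral propagation for the generators of `ℝP²_q`: for bounded operators `P, T` on a
complex Hilbert space with `P` self-adjoint, `0 ≤ P ≤ 1`, `T ≠ 0`, `q⁴ T*T = P - P²` and
`PT = q⁻⁴ TP`, every `λ ∈ Sp(P)` with `0 < λ < 1` yields `q⁻⁴λ ∈ Sp(P)`. -/
theorem stmt_13 {H : Type*} [NormedAddCommGroup H] [InnerProductSpace ℂ H] [CompleteSpace H]
    (q : ℝ) (hq : 0 < q) (hq1 : q < 1)
    (P T : H →L[ℂ] H)
    (hP : IsSelfAdjoint P)
    (hP0 : P.IsPositive) (hP1 : (1 - P).IsPositive)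
    (hT : T ≠ 0)
    (hrel : ((q : ℂ) ^ 4) • (adjoint T * T) = P - P ^ 2)
    (hcom : P * T = (((q : ℂ) ^ 4)⁻¹) • (T * P))
    (lam : ℝ) (hlam0 : 0 < lam) (hlam1 : lam < 1)
    (hspec : (lam : ℂ) ∈ spectrum ℂ P) :
    (((q ^ 4)⁻¹ * lam : ℝ) : ℂ) ∈ spectrum ℂ P := by
  have h := hP.mul_mem_spectrum hrel hcom hlam0.ne' hlam1.ne hspec
  exact_mod_cast h
end

section
/- Let q ∈ (0,1), let H be a complex Hilbert space, and let P, T be bounded operators on H with P self-adjoint, q⁴·T*T = P − P², and PT = q^{−4}TP. Then the spectrum of P is contained in the set {q^{4k} : k ∈ ℕ} ∪ {0}. -/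
/-- If `P T = c⁻¹ T P` and `c T⋆T = P - P²` with `P` self-adjoint, then `c⁻¹ l` lies in the spectrum
of `P` as soon as `l` does, unless `l` is `0` or `1`. -/
theorem inv_mul_mem_spectrum_of_mem {A : Type*} [Ring A] [StarRing A] [Algebra ℝ A]
    [StarModule ℝ A] {c l : ℝ} {P T : A} (hc : c ≠ 0) (hP : IsSelfAdjoint P)
    (hrel : c • (star T * T) = P - P ^ 2) (hcom : P * T = c⁻¹ • (T * P))
    (hl : l ∈ spectrum ℝ P) (hl0 : l ≠ 0) (hl1 : l ≠ 1) : c⁻¹ * l ∈ spectrum ℝ P := by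
  by_contra hμ
  obtain ⟨S, -, hSR⟩ := isUnit_iff_exists.mp (spectrum.notMem_iff.mp hμ)
  have hT : (algebraMap ℝ A (c⁻¹ * l) - P) * T = c⁻¹ • (T * (algebraMap ℝ A l - P)) := by
    rw [sub_mul, hcom, mul_sub, smul_sub, ← Algebra.smul_def, ← Algebra.commutes,
      ← Algebra.smul_def, smul_smul]
  have hT' : T = c⁻¹ • (S * T * (algebraMap ℝ A l - P)) := by
    calc T = S * ((algebraMap ℝ A (c⁻¹ * l) - P) * T) := by rw [← mul_assoc, hSR, one_mul]
      _ = _ := by rw [hT, mul_smul_comm, mul_assoc]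
  have hd : l - l ^ 2 ≠ 0 := by
    have : l - l ^ 2 = l * (1 - l) := by ring
    rw [this]
    exact mul_ne_zero hl0 (sub_ne_zero.mpr hl1.symm)
  obtain ⟨X, hX⟩ : ∃ X : A, X * (algebraMap ℝ A l - P) = 1 := by
    have hfac : P - P ^ 2 = star T * S * T * (algebraMap ℝ A l - P) := by
      rw [← hrel]
      conv_lhs => rw [hT']
      conv_lhs => enter [2, 1]; rw [← hT']
      rw [mul_smul_comm, smul_smul, mul_inv_cancel₀ hc, one_smul]
      simp only [mul_assoc]
    refine ⟨(l - l ^ 2)⁻¹ • (star T * S * T + (1 - P - algebraMap ℝ A l)), ?_⟩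
    have : (star T * S * T + (1 - P - algebraMap ℝ A l)) * (algebraMap ℝ A l - P)
        = (l - l ^ 2) • (1 : A) := by
      rw [add_mul, ← hfac, Algebra.smul_def, mul_one, map_sub, map_pow]
      have := Algebra.commutes l P
      simp only [sub_mul, mul_sub, one_mul, pow_two, this]
      abel
    rw [smul_mul_assoc, this, smul_smul, inv_mul_cancel₀ hd, one_smul]
  have hsa : star (algebraMap ℝ A l - P) = algebraMap ℝ A l - P := by
    rw [star_sub, hP.star_eq, ← algebraMap_star_comm, star_trivial]
  have hX' : (algebraMap ℝ A l - P) * star X = 1 := by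
    rw [← hsa, ← star_mul, hX, star_one]
  refine hl ?_
  exact isUnit_iff_exists.mpr ⟨star X, hX', by rwa [← left_inv_eq_right_inv hX hX']⟩

/-- A self-adjoint element `P` of a C⋆-algebra with `c T⋆T = P - P²` for some `c > 0` has spectrum
in the unit interval. -/
theorem mem_Icc_of_mem_spectrum {A : Type*} [CStarAlgebra A] {c l : ℝ} {P T : A} (hc : 0 < c)
    (hrel : c • (star T * T) = P - P ^ 2) (hl : l ∈ spectrum ℝ P) : l ∈ Set.Icc 0 1 := by
  have h1 : l - l ^ 2 ∈ spectrum ℝ (c • (star T * T)) := by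
    rw [hrel]
    have h := spectrum.subset_polynomial_aeval P (Polynomial.X - Polynomial.X ^ 2 : Polynomial ℝ)
      ⟨l, hl, rfl⟩
    simp only [map_sub, map_pow, Polynomial.aeval_X] at h
    simpa only [Polynomial.eval_sub, Polynomial.eval_pow, Polynomial.eval_X] using h
  have hs : c • (star T * T) = star (√c • T) * (√c • T) := by
    rw [star_smul, star_trivial √c, smul_mul_smul_comm, Real.mul_self_sqrt hc.le]
  rw [hs] at h1
  have := spectrum_star_mul_self_nonneg _ h1
  constructor <;> nlinarith

/-- A set of numbers in `[0, 1]` that is stable under division by `c ∈ (0, 1)` away from `0` and `1`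
consists of `0` and powers of `c`. -/
theorem eq_pow_of_inv_mul_mem {s : Set ℝ} {c : ℝ} (hc : 0 < c) (hc1 : c < 1)
    (hs : s ⊆ Set.Icc 0 1) (hstep : ∀ l ∈ s, l ≠ 0 → l ≠ 1 → c⁻¹ * l ∈ s)
    {l : ℝ} (hl : l ∈ s) (hl0 : l ≠ 0) : ∃ k : ℕ, l = c ^ k := by
  have hpos : 0 < l := (hs hl).1.lt_of_ne' hl0
  obtain ⟨n, hn⟩ := exists_pow_lt_of_lt_one hpos hc1
  induction n generalizing l with
  | zero => exact absurd (hs hl).2 (by simpa using hn)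
  | succ n ih =>
    by_cases h1 : l = 1
    · exact ⟨0, by simpa using h1⟩
    · have hpos' : 0 < c⁻¹ * l := by positivity
      obtain ⟨k, hk⟩ := ih (hstep l hl hl0 h1) hpos'.ne' hpos'
        (by rwa [lt_inv_mul_iff₀ hc, ← pow_succ'])
      exact ⟨k + 1, by rw [pow_succ', ← hk, mul_inv_cancel_left₀ hc.ne']⟩


open ContinuousLinearMap in
/-- The spectrum of the generator `P` of `ℝP²_q` in any bounded Hilbert-space
representation: if `P` is self-adjoint, `q⁴ T*T = P - P²` and `PT = q⁻⁴ TP`, then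
`Sp(P) ⊆ {q^{4k} : k ∈ ℕ} ∪ {0}`. -/
theorem stmt_14 {H : Type*} [NormedAddCommGroup H] [InnerProductSpace ℂ H] [CompleteSpace H]
    (q : ℝ) (hq : 0 < q) (hq1 : q < 1)
    (P T : H →L[ℂ] H)
    (hP : IsSelfAdjoint P)
    (hrel : ((q : ℂ) ^ 4) • (adjoint T * T) = P - P ^ 2)
    (hcom : P * T = (((q : ℂ) ^ 4)⁻¹) • (T * P)) :
    spectrum ℂ P ⊆ {z : ℂ | ∃ k : ℕ, z = (q : ℂ) ^ (4 * k)} ∪ {0} := by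
  have hc : 0 < q ^ 4 := by positivity
  have hrel' : (q ^ 4) • (star T * T) = P - P ^ 2 := by
    rw [← hrel, star_eq_adjoint, ← Complex.ofReal_pow, Complex.coe_smul]
  have hcom' : P * T = (q ^ 4)⁻¹ • (T * P) := by
    rw [hcom, ← Complex.ofReal_pow, ← Complex.ofReal_inv, Complex.coe_smul]
  intro z hz
  have hre : z = (z.re : ℂ) := hP.mem_spectrum_eq_re hz
  have hzr : z.re ∈ spectrum ℝ P := by
    rw [hre] at hz
    exact (spectrum.algebraMap_mem_iff ℂ).mp hz
  by_cases h0 : z.re = 0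
  · right
    rw [hre, h0]
    simp
  · left
    obtain ⟨k, hk⟩ := eq_pow_of_inv_mul_mem hc (pow_lt_one₀ hq.le hq1 (by norm_num))
      (fun l hl => mem_Icc_of_mem_spectrum hc hrel' hl)
      (fun l hl => inv_mul_mem_spectrum_of_mem hc.ne' hP hrel' hcom' hl) hzr h0
    exact ⟨k, by rw [hre, hk, ← pow_mul]; push_cast; rfl⟩
end

section
/- Let q be a nonzero complex number and let A be a (unital, associative) ring in which elements P, T, T' satisfy T·T' = −q⁴P² + P and T'·P = q^{−4}P·T'. Then for every n ∈ ℕ: T·(T')^{n+1} = (T')^n·(q^{4n}P − q^{8n+4}P²). -/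
/-- If `x` and `y` commute up to the scalar `c`, then `x` and `y ^ n` commute up to `c ^ n`. -/
theorem mul_pow_eq_smul_pow_mul {R A : Type*} [CommSemiring R] [Semiring A] [Algebra R A]
    {c : R} {x y : A} (h : x * y = c • (y * x)) (n : ℕ) :
    x * y ^ n = c ^ n • (y ^ n * x) := by
  induction n with
  | zero => simp
  | succ n ih =>
    rw [pow_succ, ← mul_assoc, ih, smul_mul_assoc, mul_assoc, h, mul_smul_comm, smul_smul,
      ← pow_succ, mul_assoc]

/-- The commutation identity `T (T')^{n+1} = (T')^n (q^{4n} P - q^{8n+4} P²)` in any unital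
complex algebra where `T T' = -q⁴P² + P` and `T' P = q⁻⁴ P T'` (in the application,
`T' = T*` in `P(ℝP²_q)`). -/
theorem stmt_15 {A : Type*} [Ring A] [Algebra ℂ A] (q : ℂ) (hq : q ≠ 0)
    (P T T' : A)
    (h1 : T * T' = (-(q ^ 4)) • P ^ 2 + P)
    (h2 : T' * P = ((q ^ 4)⁻¹) • (P * T'))
    (n : ℕ) :
    T * T' ^ (n + 1) = T' ^ n * ((q ^ (4 * n)) • P - (q ^ (8 * n + 4)) • P ^ 2) := by
  have hPT : P * T' = q ^ 4 • (T' * P) := by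
    rw [h2, smul_inv_smul₀ (pow_ne_zero 4 hq)]
  have hP : P * T' ^ n = q ^ (4 * n) • (T' ^ n * P) := by
    rw [mul_pow_eq_smul_pow_mul hPT, pow_mul]
  have hP2 : P ^ 2 * T' ^ n = q ^ (8 * n) • (T' ^ n * P ^ 2) := by
    rw [sq, mul_assoc, hP, mul_smul_comm, ← mul_assoc, hP, smul_mul_assoc, smul_smul, mul_assoc,
      ← pow_add]
    congr 2
    ring
  rw [pow_succ', ← mul_assoc, h1, add_mul, smul_mul_assoc, hP, hP2, smul_smul, mul_sub,
    mul_smul_comm, mul_smul_comm, neg_mul, neg_smul, ← pow_add, add_comm 4, neg_add_eq_sub]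
end

section
/- Let q ∈ (0,1), let H be a complex Hilbert space, and let P, T be bounded operators on H with P self-adjoint, TT* = −q⁴P² + P, and T*P = q^{−4}PT*. Suppose ξ ∈ H is a unit vector with Pξ = ξ. Then for every k ∈ ℕ: (i) P·(T*)^k ξ = q^{4k}·(T*)^k ξ; (ii) ‖(T*)^{k+1} ξ‖ = q^{2k}(1 − q^{4(k+1)})^{1/2}·‖(T*)^k ξ‖; and consequently (iii) (T*)^k ξ ≠ 0 for all k ∈ ℕ, so P has each q^{4k} as an eigenvalue. -/
open ContinuousLinearMap in
/-- If `T*P = c⁻¹PT*`, then `T*` maps the `μ`-eigenspace of `P` to the `cμ`-eigenspace. -/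
theorem apply_adjoint_eq_smul_of_apply_eq_smul {H : Type*} [NormedAddCommGroup H]
    [InnerProductSpace ℂ H] [CompleteSpace H] {P T : H →L[ℂ] H} {c μ : ℂ} (hc : c ≠ 0)
    (h : adjoint T * P = c⁻¹ • (P * adjoint T)) {v : H} (hv : P v = μ • v) :
    P (adjoint T v) = (c * μ) • adjoint T v := by
  have hTP : adjoint T (P v) = c⁻¹ • P (adjoint T v) := by
    simpa using congrArg (fun A : H →L[ℂ] H => A v) h
  rw [hv, map_smul] at hTP
  rw [mul_smul, hTP, smul_inv_smul₀ hc]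

open ContinuousLinearMap in
/-- If `TT* = -cP² + P`, then `T*` scales the squared norm on the `μ`-eigenspace of `P`
by `μ - cμ²`. -/
theorem norm_sq_adjoint_apply_of_apply_eq_smul {H : Type*} [NormedAddCommGroup H]
    [InnerProductSpace ℂ H] [CompleteSpace H] {P T : H →L[ℂ] H} {c μ : ℝ}
    (h : T * adjoint T = (-(c : ℂ)) • P ^ 2 + P) {v : H} (hv : P v = (μ : ℂ) • v) :
    ‖adjoint T v‖ ^ 2 = (μ - c * μ ^ 2) * ‖v‖ ^ 2 := by
  have hTT : T (adjoint T v) = ((μ - c * μ ^ 2 : ℝ) : ℂ) • v := by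
    have hA : T (adjoint T v) = (-(c : ℂ)) • P (P v) + P v := by
      simpa [pow_two] using congrArg (fun A : H →L[ℂ] H => A v) h
    rw [hA, hv, map_smul, hv]
    push_cast
    module
  have key : inner ℂ (adjoint T v) (adjoint T v) = inner ℂ v (T (adjoint T v)) :=
    adjoint_inner_left T (adjoint T v) v
  rw [hTT, inner_smul_right, inner_self_eq_norm_sq_to_K, inner_self_eq_norm_sq_to_K] at key
  refine Complex.ofReal_injective ?_
  push_cast at key ⊢
  exact key


open ContinuousLinearMap in
/-- Construction of the eigenvectors of `P` in the classification of irreducible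
`*`-representations of `P(ℝP²_q)`: from a unit vector `ξ` with `Pξ = ξ` and the relations
`TT* = -q⁴P² + P`, `T*P = q⁻⁴PT*`, the vectors `(T*)^k ξ` are nonzero eigenvectors of `P`
with eigenvalue `q^{4k}`, with the stated norm recursion; in particular each `q^{4k}` is
an eigenvalue of `P`. -/
theorem stmt_16 {H : Type*} [NormedAddCommGroup H] [InnerProductSpace ℂ H] [CompleteSpace H]
    (q : ℝ) (hq : 0 < q) (hq1 : q < 1)
    (P T : H →L[ℂ] H)
    (hP : IsSelfAdjoint P)
    (h1 : T * adjoint T = (-((q : ℂ) ^ 4)) • P ^ 2 + P)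
    (h2 : adjoint T * P = (((q : ℂ) ^ 4)⁻¹) • (P * adjoint T))
    (ξ : H) (hξ : ‖ξ‖ = 1) (hPξ : P ξ = ξ) :
    ∀ k : ℕ,
      P ((adjoint T ^ k) ξ) = (((q ^ (4 * k) : ℝ)) : ℂ) • ((adjoint T ^ k) ξ) ∧
      ‖(adjoint T ^ (k + 1)) ξ‖
        = q ^ (2 * k) * Real.sqrt (1 - q ^ (4 * (k + 1))) * ‖(adjoint T ^ k) ξ‖ ∧
      (adjoint T ^ k) ξ ≠ 0 ∧
      ∃ v : H, v ≠ 0 ∧ P v = (((q ^ (4 * k) : ℝ)) : ℂ) • v := by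
  have hsucc : ∀ k : ℕ, (adjoint T ^ (k + 1)) ξ = adjoint T ((adjoint T ^ k) ξ) := by
    intro k
    rw [pow_succ']
    rfl
  have heig : ∀ k : ℕ, P ((adjoint T ^ k) ξ) = ((q ^ (4 * k) : ℝ) : ℂ) • (adjoint T ^ k) ξ := by
    intro k
    induction k with
    | zero => simp [hPξ]
    | succ k ih =>
      have hc : (q : ℂ) ^ 4 ≠ 0 := pow_ne_zero _ (by exact_mod_cast hq.ne')
      rw [hsucc, apply_adjoint_eq_smul_of_apply_eq_smul hc h2 ih]
      congr 1
      push_cast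
      ring
  have hnorm : ∀ k : ℕ, ‖(adjoint T ^ (k + 1)) ξ‖
      = q ^ (2 * k) * Real.sqrt (1 - q ^ (4 * (k + 1))) * ‖(adjoint T ^ k) ξ‖ := by
    intro k
    have hsq := norm_sq_adjoint_apply_of_apply_eq_smul (c := q ^ 4)
      (by simpa using h1) (heig k)
    have hle : 0 ≤ 1 - q ^ (4 * (k + 1)) := sub_nonneg.2 (pow_le_one₀ hq.le hq1.le)
    rw [hsucc]
    refine (pow_left_inj₀ (norm_nonneg _) (by positivity) two_ne_zero).1 ?_
    rw [hsq, mul_pow, mul_pow, Real.sq_sqrt hle]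
    ring
  have hne : ∀ k : ℕ, (adjoint T ^ k) ξ ≠ 0 := by
    intro k
    induction k with
    | zero => simpa using norm_ne_zero_iff.1 (hξ.trans_ne one_ne_zero)
    | succ k ih =>
      have hlt : 0 < 1 - q ^ (4 * (k + 1)) :=
        sub_pos.2 (pow_lt_one₀ hq.le hq1 (by simp))
      rw [← norm_pos_iff, hnorm k]
      have := norm_pos_iff.2 ih
      positivity
  exact fun k => ⟨heig k, hnorm k, hne k, _, hne k, heig k⟩
end

section
/- Let q ∈ (0,1) and let S be a unital complex star-algebra containing elements A, B with A* = A, BA = q²AB, B*B = −A² + 1, BB* = −q⁴A² + 1. Suppose r₂ : S → S is a star-algebra automorphism with r₂(A) = −A, r₂(B) = −B, and r₂ ∘ r₂ = id, and define E : S → S by E(a) := ½(a + r₂(a)). Then for every a ∈ S: a = E(a) + E(aA)·A + E(aB*)·B and a = E(a) + A·E(Aa) + B*·E(Ba); moreover 1·1* + A·A* + B*·(B*)* = 1 + A² + B*B = 2·1. -/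
/-- The conditional expectation `E(a) = ½(a + r₂(a))` onto the fixed-point algebra
`P(ℝP²_q)` of the antipodal action `r₂` on the equator Podleś sphere admits the
quasi-basis `{1, A, B*}` in the sense of Watatani:
`a = E(a) + E(aA)A + E(aB*)B = E(a) + A E(Aa) + B* E(Ba)` for all `a`, and the index is
`1·1* + A·A* + B*·(B*)* = 1 + A² + B*B = 2·1`. -/
theorem stmt_19 {S : Type*} [Ring S] [Algebra ℂ S] [StarRing S] [StarModule ℂ S]
    (q : ℝ) (hq : 0 < q) (hq1 : q < 1)
    (A B : S)
    (hA : star A = A)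
    (hBA : B * A = ((q : ℂ) ^ 2) • (A * B))
    (hBsB : star B * B = -A ^ 2 + 1)
    (hBBs : B * star B = (-((q : ℂ) ^ 4)) • A ^ 2 + 1)
    (r₂ : S ≃⋆ₐ[ℂ] S) (hr₂A : r₂ A = -A) (hr₂B : r₂ B = -B)
    (hr₂invol : ∀ a : S, r₂ (r₂ a) = a)
    (E : S → S) (hE : ∀ a : S, E a = ((2 : ℂ)⁻¹) • (a + r₂ a)) :
    (∀ a : S, a = E a + E (a * A) * A + E (a * star B) * B) ∧
    (∀ a : S, a = E a + A * E (A * a) + star B * E (B * a)) ∧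
    1 * star (1 : S) + A * star A + star B * star (star B) = 1 + A ^ 2 + star B * B ∧
    (1 : S) + A ^ 2 + star B * B = 2 := by
  have hsum : A * A + star B * B = 1 := by
    rw [hBsB, ← pow_two]; abel
  have hr₂Bs : r₂ (star B) = -star B := by
    rw [map_star, hr₂B, star_neg]
  refine ⟨fun a => ?_, fun a => ?_, ?_, ?_⟩
  · have h (x : S) : x * A * A + x * star B * B = x := by
      rw [mul_assoc, mul_assoc, ← mul_add, hsum, mul_one]
    have key : (a + r₂ a) + (a * A + r₂ (a * A)) * A
        + (a * star B + r₂ (a * star B)) * B = (2 : ℂ) • a := by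
      rw [map_mul, map_mul, hr₂A, hr₂Bs, two_smul]
      linear_combination (norm := noncomm_ring) h a - h (r₂ a)
    simp only [hE, smul_mul_assoc, ← smul_add, key]
    rw [inv_smul_smul₀ two_ne_zero]
  · have h (x : S) : A * (A * x) + star B * (B * x) = x := by
      rw [← mul_assoc, ← mul_assoc, ← add_mul, hsum, one_mul]
    have key : (a + r₂ a) + A * (A * a + r₂ (A * a))
        + star B * (B * a + r₂ (B * a)) = (2 : ℂ) • a := by
      rw [map_mul, map_mul, hr₂A, hr₂B, two_smul]
      linear_combination (norm := noncomm_ring) h a - h (r₂ a)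
    simp only [hE, mul_smul_comm, ← smul_add, key]
    rw [inv_smul_smul₀ two_ne_zero]
  · rw [star_one, mul_one, hA, star_star, pow_two]
  · rw [pow_two, add_assoc, hsum, one_add_one_eq_two]
end
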